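/- arXiv:2201.10955 — 6 statements merged into one kernel-verified Lean document; each statement's English description precedes it below -/
import Mathlib

section
/- Let Γ be the subgroup of SL₂(ℤ) generated by the two matrices (1, 3; 0, 1) and (1, 0; 3, 1) (the 'Lubotzky 1-2-3 group'). Then the trace set of Γ is exactly the set of integers congruent to 2 modulo 9: every γ ∈ Γ satisfies tr(γ) ≡ 2 (mod 9), and conversely for every integer t with t ≡ 2 (mod 9) there exists γ ∈ Γ with tr(γ) = t. -/
/-- The generator `(1, 3; 0, 1)` of the Lubotzky 1-2-3 group. -/
def lubotzkyGen₁ : Matrix.SpecialLinearGroup (Fin 2) ℤ :=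
  ⟨!![1, 3; 0, 1], by simp [Matrix.det_fin_two_of]⟩

/-- The generator `(1, 0; 3, 1)` of the Lubotzky 1-2-3 group. -/
def lubotzkyGen₂ : Matrix.SpecialLinearGroup (Fin 2) ℤ :=
  ⟨!![1, 0; 3, 1], by simp [Matrix.det_fin_two_of]⟩

theorem coe_lubotzkyGen₁_zpow (k : ℤ) :
    ((lubotzkyGen₁ ^ k : Matrix.SpecialLinearGroup (Fin 2) ℤ) : Matrix (Fin 2) (Fin 2) ℤ) =
      !![1, 3 * k; 0, 1] := by
  have h : lubotzkyGen₁ = ModularGroup.T ^ (3 : ℤ) :=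
    Subtype.ext (ModularGroup.coe_T_zpow 3).symm
  rw [h, ← zpow_mul, ModularGroup.coe_T_zpow]

/-- Elements of the Lubotzky 1-2-3 group have diagonal entries congruent to `1` modulo `9` and
off-diagonal entries divisible by `3`. -/
theorem entries_of_mem_closure_lubotzkyGen {γ : Matrix.SpecialLinearGroup (Fin 2) ℤ}
    (hγ : γ ∈ Subgroup.closure {lubotzkyGen₁, lubotzkyGen₂}) :
    (∃ a, γ 0 0 = 1 + 9 * a) ∧ (∃ b, γ 0 1 = 3 * b) ∧
      (∃ c, γ 1 0 = 3 * c) ∧ (∃ d, γ 1 1 = 1 + 9 * d) := by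
  induction hγ using Subgroup.closure_induction with
  | mem x hx =>
    rcases hx with rfl | rfl
    · exact ⟨⟨0, rfl⟩, ⟨1, rfl⟩, ⟨0, rfl⟩, ⟨0, rfl⟩⟩
    · exact ⟨⟨0, rfl⟩, ⟨0, rfl⟩, ⟨1, rfl⟩, ⟨0, rfl⟩⟩
  | one => exact ⟨⟨0, rfl⟩, ⟨0, rfl⟩, ⟨0, rfl⟩, ⟨0, rfl⟩⟩
  | mul x y _ _ hx hy =>
    obtain ⟨⟨a, ha⟩, ⟨b, hb⟩, ⟨c, hc⟩, ⟨d, hd⟩⟩ := hx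
    obtain ⟨⟨a', ha'⟩, ⟨b', hb'⟩, ⟨c', hc'⟩, ⟨d', hd'⟩⟩ := hy
    simp only [Matrix.SpecialLinearGroup.coe_mul, Matrix.mul_apply, Fin.sum_univ_two,
      ha, hb, hc, hd, ha', hb', hc', hd']
    exact ⟨⟨a + a' + 9 * a * a' + b * c', by ring⟩,
      ⟨b' + 9 * a * b' + b + 9 * b * d', by ring⟩,
      ⟨c + 9 * c * a' + c' + 9 * d * c', by ring⟩,
      ⟨d + d' + 9 * d * d' + c * b', by ring⟩⟩
  | inv x _ hx =>
    obtain ⟨⟨a, ha⟩, ⟨b, hb⟩, ⟨c, hc⟩, ⟨d, hd⟩⟩ := hx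
    rw [Matrix.SpecialLinearGroup.SL2_inv_expl]
    exact ⟨⟨d, hd⟩, ⟨-b, by simp [hb]⟩, ⟨-c, by simp [hc]⟩, ⟨a, ha⟩⟩

/-- The trace set of the Lubotzky 1-2-3 group `⟨(1,3;0,1), (1,0;3,1)⟩ ≤ SL₂(ℤ)` is
exactly the set of integers congruent to `2` modulo `9`. -/
theorem lubotzky123_trace_set :
    (∀ γ ∈ Subgroup.closure {lubotzkyGen₁, lubotzkyGen₂},
      Matrix.trace ((γ : Matrix.SpecialLinearGroup (Fin 2) ℤ) : Matrix (Fin 2) (Fin 2) ℤ)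
        ≡ 2 [ZMOD 9]) ∧
    (∀ t : ℤ, t ≡ 2 [ZMOD 9] →
      ∃ γ ∈ Subgroup.closure {lubotzkyGen₁, lubotzkyGen₂},
        Matrix.trace ((γ : Matrix.SpecialLinearGroup (Fin 2) ℤ) : Matrix (Fin 2) (Fin 2) ℤ)
          = t) := by
  refine ⟨fun γ hγ => ?_, fun t ht => ?_⟩
  · obtain ⟨⟨a, ha⟩, -, -, ⟨d, hd⟩⟩ := entries_of_mem_closure_lubotzkyGen hγ
    rw [Matrix.trace_fin_two, ha, hd]
    exact (Int.modEq_iff_dvd.mpr ⟨a + d, by ring⟩).symm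
  · obtain ⟨k, hk⟩ := ht.symm.dvd
    refine ⟨lubotzkyGen₁ ^ k * lubotzkyGen₂,
      mul_mem (zpow_mem (Subgroup.subset_closure (by simp)) k)
        (Subgroup.subset_closure (by simp)), ?_⟩
    rw [Matrix.SpecialLinearGroup.coe_mul, coe_lubotzkyGen₁_zpow]
    simp [lubotzkyGen₂, Matrix.trace_fin_two]
    linarith
end

section
/- Let p be a prime, ℓ ≥ 1, and q = p^ℓ. Let A, B, C, D be integers with p ∤ gcd(A, B, C, D), and set Δ := A·D − B·C. Then for every integer n, Σ_{γ ∈ SL₂(ℤ/qℤ)} c_q(ℒ(γ) − n) = Σ_{γ = (a, b; c, d) ∈ SL₂(ℤ/qℤ)} c_q(a + Δ·d − n). -/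
/-- The Ramanujan sum `c_q(x) = Σ_{r (mod q), gcd(r,q)=1} e^{2πi r x / q}`,
viewed as a function of `x ∈ ℤ/qℤ`. -/
noncomputable def ramanujanSum (q : ℕ) (x : ZMod q) : ℂ :=
  ∑ r ∈ (Finset.range q).filter (fun r => Nat.Coprime r q),
    Complex.exp (2 * Real.pi * Complex.I * ((r * x.val : ℕ) : ℂ) / q)

/-- The linear form `ℒ(γ) = A·a + B·b + C·c + D·d` on `SL₂(ℤ/qℤ)`. -/
def Lform (A B C D : ℤ) {q : ℕ} (γ : Matrix.SpecialLinearGroup (Fin 2) (ZMod q)) : ZMod q :=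
  (A : ZMod q) * γ.1 0 0 + (B : ZMod q) * γ.1 0 1 +
    (C : ZMod q) * γ.1 1 0 + (D : ZMod q) * γ.1 1 1

/-- Summing a function of a linear form over `SL₂(R)` only depends on the determinant of the
matrix of coefficients, as soon as the first coefficient is a unit. -/
theorem sum_SL2_linear_eq_diagonal_of_isUnit {R M : Type*} [CommRing R] [AddCommMonoid M]
    [Fintype (Matrix.SpecialLinearGroup (Fin 2) R)] (f : R → M) {a : R} (b c d : R)
    (ha : IsUnit a) :
    ∑ γ : Matrix.SpecialLinearGroup (Fin 2) R,
        f (a * γ.1 0 0 + b * γ.1 0 1 + c * γ.1 1 0 + d * γ.1 1 1) =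
      ∑ γ : Matrix.SpecialLinearGroup (Fin 2) R,
        f (γ.1 0 0 + (a * d - b * c) * γ.1 1 1) := by
  obtain ⟨u, hu⟩ := ha.exists_right_inv
  let P : Matrix.SpecialLinearGroup (Fin 2) R := ⟨!![1, c * u; 0, 1], by simp⟩
  let Q : Matrix.SpecialLinearGroup (Fin 2) R := ⟨!![a, 0; b, u], by simp [hu]⟩
  refine Fintype.sum_equiv ((Equiv.mulLeft P).trans (Equiv.mulRight Q)) _ _ fun γ => ?_
  congr 1
  have hγ : (((Equiv.mulLeft P).trans (Equiv.mulRight Q)) γ).1 = P.1 * γ.1 * Q.1 := rfl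
  rw [hγ]
  simp only [P, Q, Matrix.mul_apply, Fin.sum_univ_two, Matrix.of_apply, Matrix.cons_val_zero,
    Matrix.cons_val_one, Matrix.cons_val', Matrix.cons_val_fin_one]
  linear_combination (-(c * γ.1 1 0) - d * γ.1 1 1) * hu

/-- Summing a function of a linear form over `SL₂(R)` only depends on the determinant of the
matrix of coefficients, as soon as some coefficient is a unit. -/
theorem sum_SL2_linear_eq_diagonal {R M : Type*} [CommRing R] [AddCommMonoid M]
    [Fintype (Matrix.SpecialLinearGroup (Fin 2) R)] (f : R → M) (a b c d : R)
    (h : IsUnit a ∨ IsUnit b ∨ IsUnit c ∨ IsUnit d) :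
    ∑ γ : Matrix.SpecialLinearGroup (Fin 2) R,
        f (a * γ.1 0 0 + b * γ.1 0 1 + c * γ.1 1 0 + d * γ.1 1 1) =
      ∑ γ : Matrix.SpecialLinearGroup (Fin 2) R,
        f (γ.1 0 0 + (a * d - b * c) * γ.1 1 1) := by
  let w : Matrix.SpecialLinearGroup (Fin 2) R := ⟨!![0, -1; 1, 0], by simp⟩
  have swap_cols : ∀ a b c d : R, ∑ γ : Matrix.SpecialLinearGroup (Fin 2) R,
        f (a * γ.1 0 0 + b * γ.1 0 1 + c * γ.1 1 0 + d * γ.1 1 1) =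
      ∑ γ : Matrix.SpecialLinearGroup (Fin 2) R,
        f (b * γ.1 0 0 + -a * γ.1 0 1 + d * γ.1 1 0 + -c * γ.1 1 1) := by
    intro a b c d
    refine Fintype.sum_equiv (Equiv.mulRight w) _ _ fun γ => ?_
    congr 1
    have hγ : (Equiv.mulRight w γ).1 = γ.1 * w.1 := rfl
    rw [hγ]
    simp [w, Matrix.mul_apply, Fin.sum_univ_two]
    ring
  have swap_rows : ∀ a b c d : R, ∑ γ : Matrix.SpecialLinearGroup (Fin 2) R,
        f (a * γ.1 0 0 + b * γ.1 0 1 + c * γ.1 1 0 + d * γ.1 1 1) =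
      ∑ γ : Matrix.SpecialLinearGroup (Fin 2) R,
        f (-c * γ.1 0 0 + -d * γ.1 0 1 + a * γ.1 1 0 + b * γ.1 1 1) := by
    intro a b c d
    refine Fintype.sum_equiv (Equiv.mulLeft w) _ _ fun γ => ?_
    congr 1
    have hγ : (Equiv.mulLeft w γ).1 = w.1 * γ.1 := rfl
    rw [hγ]
    simp [w, Matrix.mul_apply, Fin.sum_univ_two]
    ring
  rcases h with h | h | h | h
  · exact sum_SL2_linear_eq_diagonal_of_isUnit f b c d h
  · rw [swap_cols, sum_SL2_linear_eq_diagonal_of_isUnit f _ _ _ h]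
    exact Finset.sum_congr rfl fun γ _ => congrArg f (by ring)
  · rw [swap_rows, sum_SL2_linear_eq_diagonal_of_isUnit f _ _ _ h.neg]
    exact Finset.sum_congr rfl fun γ _ => congrArg f (by ring)
  · rw [swap_rows, swap_cols, sum_SL2_linear_eq_diagonal_of_isUnit f _ _ _ h.neg]
    exact Finset.sum_congr rfl fun γ _ => congrArg f (by ring)

theorem ZMod.isUnit_intCast_prime_pow_of_not_dvd {p : ℕ} [Fact p.Prime] (ℓ : ℕ) {x : ℤ}
    (hx : ¬ (p : ℤ) ∣ x) : IsUnit (x : ZMod (p ^ ℓ)) := by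
  rw [ZMod.coe_int_isUnit_iff_isCoprime]
  push_cast
  exact ((Nat.prime_iff_prime_int.mp Fact.out).coprime_iff_not_dvd.mpr hx).pow_left

/-- For `q = p^ℓ` a prime power with `p ∤ gcd(A,B,C,D)`, the singular-series sum
`Σ_{γ ∈ SL₂(ℤ/qℤ)} c_q(ℒ(γ) − n)` equals `Σ_{(a,b;c,d) ∈ SL₂(ℤ/qℤ)} c_q(a + Δ·d − n)`,
where `Δ = AD − BC`. -/
theorem singSeries_reduce_to_diagonal (p : ℕ) [Fact p.Prime] (ℓ : ℕ) (hℓ : 1 ≤ ℓ)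
    (A B C D : ℤ) (hgcd : ¬ p ∣ Int.gcd A (Int.gcd B (Int.gcd C D))) (n : ℤ) :
    (∑ γ : Matrix.SpecialLinearGroup (Fin 2) (ZMod (p ^ ℓ)),
        ramanujanSum (p ^ ℓ) (Lform A B C D γ - (n : ZMod (p ^ ℓ)))) =
    ∑ γ : Matrix.SpecialLinearGroup (Fin 2) (ZMod (p ^ ℓ)),
        ramanujanSum (p ^ ℓ)
          (γ.1 0 0 + ((A * D - B * C : ℤ) : ZMod (p ^ ℓ)) * γ.1 1 1 - (n : ZMod (p ^ ℓ))) := by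
  have hdvd : ¬ ((p : ℤ) ∣ A ∧ (p : ℤ) ∣ B ∧ (p : ℤ) ∣ C ∧ (p : ℤ) ∣ D) := by
    rintro ⟨hA, hB, hC, hD⟩
    have h := Int.dvd_coe_gcd hA (Int.dvd_coe_gcd hB (Int.dvd_coe_gcd hC hD))
    exact hgcd (by exact_mod_cast h)
  have hunit : IsUnit (A : ZMod (p ^ ℓ)) ∨ IsUnit (B : ZMod (p ^ ℓ)) ∨
      IsUnit (C : ZMod (p ^ ℓ)) ∨ IsUnit (D : ZMod (p ^ ℓ)) := by
    have key := fun x : ℤ => ZMod.isUnit_intCast_prime_pow_of_not_dvd (p := p) ℓ (x := x)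
    have := key A
    have := key B
    have := key C
    have := key D
    tauto
  push_cast
  exact sum_SL2_linear_eq_diagonal (fun x => ramanujanSum (p ^ ℓ) (x - n)) _ _ _ _ hunit
end

section
/- Let p be a prime and Δ an integer with p ∣ Δ. Then for every integer n, |SL₂(ℤ/pℤ)|⁻¹ · Σ_{γ = (a, b; c, d) ∈ SL₂(ℤ/pℤ)} c_p(a + Δ·d − n) equals −1/(p+1) if p ∣ n, and equals 1/(p²−1) if p ∤ n. -/
open Matrix in
/-- Over a field, elements of `SL₂` with a fixed nonzero upper-left entry are parametrised by their
off-diagonal entries. -/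
def Matrix.SpecialLinearGroup.equivOfApplyZeroZero {K : Type*} [Field K] {α : K} (hα : α ≠ 0) :
    {γ : SpecialLinearGroup (Fin 2) K // γ.1 0 0 = α} ≃ K × K where
  toFun γ := (γ.1.1 0 1, γ.1.1 1 0)
  invFun x := ⟨⟨!![α, x.1; x.2, (1 + x.1 * x.2) / α], by
    rw [det_fin_two_of]; field_simp; ring⟩, by simp⟩
  left_inv := by
    rintro ⟨⟨m, hm⟩, h⟩
    rw [det_fin_two] at hm
    simp only at h
    ext i j
    fin_cases i <;> fin_cases j <;> simp [h]
    rw [h] at hm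
    field_simp
    linear_combination -hm
  right_inv x := by simp

open Matrix in
/-- Over a field, elements of `SL₂` whose upper-left entry vanishes are parametrised by their
upper-right entry, which is a unit, and their lower-right entry. -/
def Matrix.SpecialLinearGroup.equivOfApplyZeroZeroEqZero (K : Type*) [Field K] :
    {γ : SpecialLinearGroup (Fin 2) K // γ.1 0 0 = 0} ≃ Kˣ × K where
  toFun γ := (⟨γ.1.1 0 1, -γ.1.1 1 0, by
      have := γ.1.2
      rw [det_fin_two, γ.2] at this
      linear_combination this, by
      have := γ.1.2
      rw [det_fin_two, γ.2] at this
      linear_combination this⟩, γ.1.1 1 1)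
  invFun x := ⟨⟨!![0, (x.1 : K); -((x.1⁻¹ : Kˣ) : K), x.2], by
    rw [det_fin_two_of]; simp⟩, by simp⟩
  left_inv := by
    rintro ⟨⟨m, hm⟩, h⟩
    simp only at h
    ext i j
    fin_cases i <;> fin_cases j <;> simp [h]
  right_inv x := by
    ext <;> simp

open Matrix in
theorem Matrix.SpecialLinearGroup.card_filter_apply_zero_zero_eq {K : Type*} [Field K] [Fintype K]
    [DecidableEq K] (α : K) :
    (Finset.univ.filter fun γ : SpecialLinearGroup (Fin 2) K => γ.1 0 0 = α).card =
      if α = 0 then (Fintype.card K - 1) * Fintype.card K else Fintype.card K ^ 2 := by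
  rw [← Fintype.card_subtype]
  split_ifs with hα
  · subst hα
    rw [Fintype.card_congr (equivOfApplyZeroZeroEqZero K), Fintype.card_prod, Fintype.card_units]
  · rw [Fintype.card_congr (equivOfApplyZeroZero hα), Fintype.card_prod, sq]

open Matrix in
theorem Matrix.SpecialLinearGroup.card_fin_two (K : Type*) [Field K] [Fintype K] [DecidableEq K] :
    Fintype.card (SpecialLinearGroup (Fin 2) K) =
      (Fintype.card K - 1) * Fintype.card K + (Fintype.card K - 1) * Fintype.card K ^ 2 := by
  rw [← Finset.card_univ, Finset.card_eq_sum_card_fiberwise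
    (f := fun γ : SpecialLinearGroup (Fin 2) K => γ.1 0 0) (t := Finset.univ) (by simp)]
  simp only [card_filter_apply_zero_zero_eq]
  rw [← Finset.add_sum_erase _ _ (Finset.mem_univ (0 : K)), if_pos rfl,
    Finset.sum_congr rfl fun x hx => if_neg (Finset.ne_of_mem_erase hx), Finset.sum_const,
    Finset.card_erase_of_mem (Finset.mem_univ _), Finset.card_univ, smul_eq_mul]

theorem ramanujanSum_prime (p : ℕ) [Fact p.Prime] (x : ZMod p) :
    ramanujanSum p x = (if x = 0 then (p : ℂ) else 0) - 1 := by
  have hp : p.Prime := Fact.out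
  have hterm (r : ℕ) : Complex.exp (2 * Real.pi * Complex.I * ((r * x.val : ℕ) : ℂ) / p) =
      ZMod.stdAddChar ((r : ZMod p) * x) := by
    have h := ZMod.stdAddChar_coe (N := p) ((r * x.val : ℕ) : ℤ)
    rw [Int.cast_natCast, Int.cast_natCast] at h
    rw [← h, Nat.cast_mul, ZMod.natCast_zmod_val]
  have hfull : ∑ r ∈ Finset.range p, ZMod.stdAddChar ((r : ZMod p) * x) =
      if x = 0 then (p : ℂ) else 0 := by
    have h := AddChar.sum_mulShift x (ZMod.isPrimitive_stdAddChar p)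
    rw [ZMod.card] at h
    push_cast at h
    rw [← h]
    exact Finset.sum_nbij' (fun r : ℕ => (r : ZMod p)) ZMod.val (by simp)
      (fun a _ => Finset.mem_range.mpr a.val_lt)
      (fun r hr => ZMod.val_cast_of_lt (Finset.mem_range.mp hr)) (by simp) (fun _ _ => rfl)
  have hfilter : (Finset.range p).filter (fun r => Nat.Coprime r p) =
      (Finset.range p).erase 0 := by
    ext r
    simp only [Finset.mem_filter, Finset.mem_range, Finset.mem_erase]
    refine ⟨fun ⟨h, hc⟩ => ⟨?_, h⟩, fun ⟨h0, h⟩ => ⟨h, ?_⟩⟩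
    · rintro rfl
      exact hp.one_lt.ne' ((Nat.coprime_zero_left p).mp hc)
    · exact (Nat.coprime_of_lt_prime h0 h hp).symm
  rw [ramanujanSum, Finset.sum_congr hfilter fun r _ => hterm r, ← hfull,
    ← Finset.add_sum_erase _ _ (Finset.mem_range.mpr hp.pos)]
  simp

/-- Evaluation of the local singular series at a prime `p ∣ Δ`:
`|SL₂(ℤ/pℤ)|⁻¹ Σ_{(a,b;c,d) ∈ SL₂(ℤ/pℤ)} c_p(a + Δd − n)` is `−1/(p+1)` if `p ∣ n`
and `1/(p²−1)` otherwise. -/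
theorem singSeries_prime_delta_eq_zero (p : ℕ) [Fact p.Prime] (Δ : ℤ) (hΔ : (p : ℤ) ∣ Δ)
    (n : ℤ) :
    (Fintype.card (Matrix.SpecialLinearGroup (Fin 2) (ZMod p)) : ℂ)⁻¹ *
      (∑ γ : Matrix.SpecialLinearGroup (Fin 2) (ZMod p),
        ramanujanSum p (γ.1 0 0 + (Δ : ZMod p) * γ.1 1 1 - (n : ZMod p))) =
    if (p : ℤ) ∣ n then -1 / ((p : ℂ) + 1) else 1 / ((p : ℂ) ^ 2 - 1) := by
  have hp : p.Prime := Fact.out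
  have hΔ0 : (Δ : ZMod p) = 0 := (ZMod.intCast_zmod_eq_zero_iff_dvd Δ p).mpr hΔ
  have hp0 : (p : ℂ) ≠ 0 := Nat.cast_ne_zero.mpr hp.ne_zero
  have hp1 : (p : ℂ) - 1 ≠ 0 := sub_ne_zero.mpr (Nat.cast_ne_one.mpr hp.ne_one)
  have hp2 : (p : ℂ) + 1 ≠ 0 := Nat.cast_add_one_ne_zero p
  have hcard : (Fintype.card (Matrix.SpecialLinearGroup (Fin 2) (ZMod p)) : ℂ) =
      p * (p - 1) * (p + 1) := by
    rw [Matrix.SpecialLinearGroup.card_fin_two, ZMod.card]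
    push_cast [Nat.cast_sub hp.one_le]
    ring
  have hsum : ∑ γ : Matrix.SpecialLinearGroup (Fin 2) (ZMod p),
      ramanujanSum p (γ.1 0 0 + (Δ : ZMod p) * γ.1 1 1 - (n : ZMod p)) =
      (if (p : ℤ) ∣ n then ((p : ℂ) - 1) * p else (p : ℂ) ^ 2) * p - p * (p - 1) * (p + 1) := by
    simp only [ramanujanSum_prime, hΔ0, zero_mul, add_zero, sub_eq_zero, Finset.sum_sub_distrib,
      ← Finset.sum_filter, Finset.sum_const, nsmul_eq_mul, mul_one, Finset.card_univ, hcard,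
      Matrix.SpecialLinearGroup.card_filter_apply_zero_zero_eq, ZMod.card,
      ZMod.intCast_zmod_eq_zero_iff_dvd]
    push_cast [Nat.cast_sub hp.one_le]
    rfl
  rw [hcard, hsum]
  split_ifs
  · field_simp
    ring
  · rw [show (p : ℂ) ^ 2 - 1 = (p - 1) * (p + 1) by ring]
    field_simp
    ring
end

section
/- Let p be a prime, Δ an integer with p ∣ Δ, and ℓ ≥ 2. Then for every integer n, Σ_{γ = (a, b; c, d) ∈ SL₂(ℤ/p^ℓℤ)} c_{p^ℓ}(a + Δ·d − n) = 0. -/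
/-- The Ramanujan sum in terms of the standard additive character of `ZMod q`. -/
theorem ramanujanSum_eq_sum_stdAddChar (q : ℕ) [NeZero q] (x : ZMod q) :
    ramanujanSum q x =
      ∑ r ∈ (Finset.range q).filter (fun r => Nat.Coprime r q),
        ZMod.stdAddChar ((r : ZMod q) * x) := by
  refine Finset.sum_congr rfl fun r _ => ?_
  have h : (r : ZMod q) * x = (((r * x.val : ℕ) : ℤ) : ZMod q) := by
    simp
  rw [h, ZMod.stdAddChar_coe]
  norm_cast

/-- The entries of a left translate in `SL₂`. -/
theorem specialLinearGroup_mulLeft_apply {R : Type*} [CommRing R]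
    (u γ : Matrix.SpecialLinearGroup (Fin 2) R) (i j : Fin 2) :
    (Equiv.mulLeft u γ).1 i j = u.1 i 0 * γ.1 0 j + u.1 i 1 * γ.1 1 j := by
  change (u.1 * γ.1) i j = _
  rw [Matrix.mul_apply, Fin.sum_univ_two]

theorem card_nsmul_eq_sum_const {R M : Type*} [Fintype R] [AddCommMonoid M] (x : M) :
    Fintype.card R • x = ∑ _t : R, x := by
  rw [Finset.sum_const, Finset.card_univ]

/-- Summing a primitive additive character over `SL₂` only sees the upper triangular matrices:
translating by upper unipotent matrices cancels everything with nonzero lower left entry. -/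
theorem card_mul_sum_addChar_specialLinearGroup {R : Type*} [CommRing R] [Fintype R]
    [DecidableEq R] {ψ : AddChar R ℂ} (hψ : ψ.IsPrimitive) (r : Rˣ) (δ : R) :
    (Fintype.card R : ℂ) * ∑ γ : Matrix.SpecialLinearGroup (Fin 2) R,
        ψ (r * (γ.1 0 0 + δ * γ.1 1 1)) =
      ∑ γ : Matrix.SpecialLinearGroup (Fin 2) R,
        ψ (r * (γ.1 0 0 + δ * γ.1 1 1)) *
          (if γ.1 1 0 = 0 then (Fintype.card R : ℂ) else 0) := by
  have translate (t : R) : ∑ γ : Matrix.SpecialLinearGroup (Fin 2) R,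
        ψ (r * (γ.1 0 0 + δ * γ.1 1 1)) =
      ∑ γ : Matrix.SpecialLinearGroup (Fin 2) R,
        ψ (r * (γ.1 0 0 + δ * γ.1 1 1)) * ψ (t * (r * γ.1 1 0)) := by
    let u : Matrix.SpecialLinearGroup (Fin 2) R := ⟨!![1, t; 0, 1], by simp⟩
    rw [← Equiv.sum_comp (Equiv.mulLeft u)]
    refine Finset.sum_congr rfl fun γ _ => ?_
    rw [← AddChar.map_add_eq_mul]
    congr 1
    simp only [specialLinearGroup_mulLeft_apply]
    simp [u]
    ring
  rw [← nsmul_eq_mul, card_nsmul_eq_sum_const,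
    Finset.sum_congr rfl fun t _ => translate t, Finset.sum_comm]
  refine Finset.sum_congr rfl fun γ _ => ?_
  rw [← Finset.mul_sum, AddChar.sum_mulShift _ hψ]
  simp

/-- If `π ≠ 0`, `π ^ 2 = 0` and `δ * π = 0`, then a primitive additive character evaluated at
unit multiples of `a + δ * d` sums to zero over `SL₂`. -/
theorem sum_addChar_specialLinearGroup_eq_zero {R : Type*} [CommRing R] [Fintype R]
    [DecidableEq R] {ψ : AddChar R ℂ} (hψ : ψ.IsPrimitive) (r : Rˣ) {δ π : R}
    (hπ : π ≠ 0) (hsq : π ^ 2 = 0) (hδ : δ * π = 0) :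
    ∑ γ : Matrix.SpecialLinearGroup (Fin 2) R,
        ψ (r * (γ.1 0 0 + δ * γ.1 1 1)) = 0 := by
  have hcard : (Fintype.card R : ℂ) ≠ 0 := Nat.cast_ne_zero.2 Fintype.card_ne_zero
  refine (mul_eq_zero.1 ?_).resolve_left hcard
  rw [card_mul_sum_addChar_specialLinearGroup hψ]
  have scale (s : R) : ∑ γ : Matrix.SpecialLinearGroup (Fin 2) R,
        ψ (r * (γ.1 0 0 + δ * γ.1 1 1)) *
          (if γ.1 1 0 = 0 then (Fintype.card R : ℂ) else 0) =
      ∑ γ : Matrix.SpecialLinearGroup (Fin 2) R,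
        ψ (r * (γ.1 0 0 + δ * γ.1 1 1)) *
          (if γ.1 1 0 = 0 then (Fintype.card R : ℂ) else 0) * ψ (s * (r * (π * γ.1 0 0))) := by
    have hdet : (1 + π * s) * (1 - π * s) = 1 := by linear_combination -s ^ 2 * hsq
    let u : Matrix.SpecialLinearGroup (Fin 2) R :=
      ⟨!![1 + π * s, 0; 0, 1 - π * s], by simpa using hdet⟩
    rw [← Equiv.sum_comp (Equiv.mulLeft u)]
    refine Finset.sum_congr rfl fun γ _ => ?_
    rw [mul_right_comm, ← AddChar.map_add_eq_mul]
    have hunit : IsUnit (1 - π * s) := IsUnit.of_mul_eq_one_right _ hdet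
    have h00 : ((Equiv.mulLeft u) γ).1 0 0 = (1 + π * s) * γ.1 0 0 := by
      rw [specialLinearGroup_mulLeft_apply]; simp [u]
    have h10 : ((Equiv.mulLeft u) γ).1 1 0 = (1 - π * s) * γ.1 1 0 := by
      rw [specialLinearGroup_mulLeft_apply]; simp [u]
    have h11 : ((Equiv.mulLeft u) γ).1 1 1 = (1 - π * s) * γ.1 1 1 := by
      rw [specialLinearGroup_mulLeft_apply]; simp [u]
    rw [h00, h10, h11]
    simp only [hunit.mul_right_eq_zero]
    congr 2
    linear_combination -(r * s * γ.1 1 1) * hδ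
  refine (smul_eq_zero.1 ?_).resolve_left (Fintype.card_ne_zero (α := R))
  rw [card_nsmul_eq_sum_const, Finset.sum_congr rfl fun s _ => scale s, Finset.sum_comm]
  refine Finset.sum_eq_zero fun γ _ => ?_
  rw [← Finset.mul_sum, AddChar.sum_mulShift _ hψ]
  by_cases hc : γ.1 1 0 = 0
  · have hdet : γ.1 0 0 * γ.1 1 1 = 1 := by
      have := γ.2
      rw [Matrix.det_fin_two, hc] at this
      simpa using this
    have hne : r * (π * γ.1 0 0) ≠ 0 := by
      rw [Ne, r.isUnit.mul_right_eq_zero, (IsUnit.of_mul_eq_one _ hdet).mul_left_eq_zero]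
      exact hπ
    simp [hne]
  · simp [hc]

/-- For `p ∣ Δ` and `ℓ ≥ 2`, the local singular series sum
`Σ_{(a,b;c,d) ∈ SL₂(ℤ/p^ℓℤ)} c_{p^ℓ}(a + Δd − n)` vanishes. -/
theorem singSeries_primePow_delta_eq_zero (p : ℕ) [Fact p.Prime] (Δ : ℤ)
    (hΔ : (p : ℤ) ∣ Δ) (ℓ : ℕ) (hℓ : 2 ≤ ℓ) (n : ℤ) :
    (∑ γ : Matrix.SpecialLinearGroup (Fin 2) (ZMod (p ^ ℓ)),
      ramanujanSum (p ^ ℓ)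
        (γ.1 0 0 + (Δ : ZMod (p ^ ℓ)) * γ.1 1 1 - (n : ZMod (p ^ ℓ)))) = 0 := by
  have hp : p.Prime := Fact.out
  have : NeZero (p ^ ℓ) := ⟨pow_ne_zero _ hp.ne_zero⟩
  have hpow : (p : ZMod (p ^ ℓ)) ^ ℓ = 0 := by
    exact_mod_cast ZMod.natCast_self (p ^ ℓ)
  have hπ : (p : ZMod (p ^ ℓ)) ^ (ℓ - 1) ≠ 0 := by
    rw [← Nat.cast_pow, Ne, ZMod.natCast_eq_zero_iff, Nat.pow_dvd_pow_iff_le_right hp.one_lt]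
    omega
  have hsq : ((p : ZMod (p ^ ℓ)) ^ (ℓ - 1)) ^ 2 = 0 := by
    rw [← pow_mul]
    exact pow_eq_zero_of_le (by omega) hpow
  have hδ : (Δ : ZMod (p ^ ℓ)) * (p : ZMod (p ^ ℓ)) ^ (ℓ - 1) = 0 := by
    obtain ⟨k, rfl⟩ := hΔ
    have h : (p : ZMod (p ^ ℓ)) * (p : ZMod (p ^ ℓ)) ^ (ℓ - 1) = 0 := by
      rw [← pow_succ', Nat.sub_add_cancel (by omega), hpow]
    push_cast
    linear_combination (k : ZMod (p ^ ℓ)) * h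
  simp only [ramanujanSum_eq_sum_stdAddChar]
  rw [Finset.sum_comm]
  refine Finset.sum_eq_zero fun r hr => ?_
  have hsum := sum_addChar_specialLinearGroup_eq_zero (ZMod.isPrimitive_stdAddChar (p ^ ℓ))
    (ZMod.unitOfCoprime r (Finset.mem_filter.1 hr).2) hπ hsq hδ
  rw [ZMod.coe_unitOfCoprime] at hsum
  simp only [mul_sub, sub_eq_add_neg _ ((r : ZMod (p ^ ℓ)) * n), AddChar.map_add_eq_mul]
  rw [← Finset.sum_mul, hsum, zero_mul]
end

section
/- Let p be an odd prime, Δ an integer with p ∤ Δ, ℓ ≥ 2, and n an integer with n² ≠ 4Δ. Let L be the p-adic valuation of n² − 4Δ, and set 𝔖 := |SL₂(ℤ/p^ℓℤ)|⁻¹ · Σ_{γ = (a, b; c, d) ∈ SL₂(ℤ/p^ℓℤ)} c_{p^ℓ}(a + Δ·d − n). Then: (i) if L ≤ ℓ−2, or if ℓ is odd and L ≥ ℓ, then 𝔖 = 0; (ii) if ℓ is odd and L = ℓ−1, then 𝔖 = χ_p((n² − 4Δ)/p^L) · p^{−(ℓ−3)/2} / (p² − 1); (iii) if ℓ is even and L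 ≥ ℓ, then 𝔖 = p^{−(ℓ−2)/2} / (p + 1); (iv) if ℓ is even and L = ℓ−1, then 𝔖 = −p^{−(ℓ−2)/2} / (p² − 1). -/
/-- Counting residues `a * v` modulo `a * m * k` for which the class of `v` modulo `m` satisfies
a given predicate. -/
lemma ZMod.card_filter_exists_mul {N a m k : ℕ} [NeZero N] [NeZero m] (hN : N = a * m * k)
    (Q : ZMod m → Prop) [DecidablePred Q] (P : ZMod N → Prop) [DecidablePred P]
    (hP : ∀ u, P u ↔ ∃ v : ℕ, u = (a : ZMod N) * v ∧ Q v) :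
    (Finset.univ.filter P).card = k * (Finset.univ.filter Q).card := by
  have hN0 : 0 < a * m * k := hN ▸ Nat.pos_of_ne_zero (NeZero.ne N)
  have ha : 0 < a := Nat.pos_of_ne_zero (by rintro rfl; simp at hN0)
  have hm : 0 < m := Nat.pos_of_ne_zero (NeZero.ne m)
  have hk : 0 < k := Nat.pos_of_ne_zero (by rintro rfl; simp at hN0)
  have key : (Finset.range k ×ˢ Finset.univ.filter Q).card = (Finset.univ.filter P).card := by
    refine Finset.card_bij (fun x _ => ((a * (x.2.val + m * x.1) : ℕ) : ZMod N)) ?_ ?_ ?_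
    · rintro ⟨w, v⟩ h
      simp only [Finset.mem_product, Finset.mem_filter, Finset.mem_univ, true_and] at h ⊢
      rw [hP]
      exact ⟨v.val + m * w, by push_cast; ring, by simpa using h.2⟩
    · have hlt : ∀ (w : ℕ) (v : ZMod m), w < k → a * (v.val + m * w) < N := by
        intro w v hw
        have h1 := v.val_lt
        have h2 : v.val + m * w < m * k := by nlinarith
        calc a * (v.val + m * w) < a * (m * k) := (Nat.mul_lt_mul_left ha).2 h2
          _ = N := by rw [hN]; ring
      rintro ⟨w, v⟩ h ⟨w', v'⟩ h' he
      simp only [Finset.mem_product, Finset.mem_filter, Finset.mem_univ, true_and,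
        Finset.mem_range] at h h'
      dsimp only at he
      rw [ZMod.natCast_eq_natCast_iff', Nat.mod_eq_of_lt (hlt _ _ h.1),
        Nat.mod_eq_of_lt (hlt _ _ h'.1)] at he
      have he' := Nat.eq_of_mul_eq_mul_left ha he
      have e1 : v.val = v'.val := by
        have := congrArg (· % m) he'
        simpa [Nat.add_mul_mod_self_left, Nat.mod_eq_of_lt v.val_lt,
          Nat.mod_eq_of_lt v'.val_lt] using this
      have e2 : w = w' := by
        rw [e1] at he'
        exact Nat.eq_of_mul_eq_mul_left hm (Nat.add_left_cancel he')
      rw [e2, ZMod.val_injective m e1]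
    · intro u hu
      simp only [Finset.mem_filter, Finset.mem_univ, true_and, hP] at hu
      obtain ⟨v, rfl, hv⟩ := hu
      refine ⟨((v / m) % k, (v : ZMod m)), ?_, ?_⟩
      · simpa [Nat.mod_lt _ hk] using hv
      · have e : v % (m * k) = (v : ZMod m).val + m * ((v / m) % k) := by
          rw [ZMod.val_natCast, Nat.mod_mul]
        dsimp only
        rw [← e, ← Nat.mul_mod_mul_left, ← Nat.cast_mul,
          show a * (m * k) = N by rw [hN]; ring, ZMod.natCast_mod]
  rw [← key, Finset.card_product, Finset.card_range]

/-- The number of multiples of `p ^ j` in `ZMod (p ^ ℓ)`. -/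
lemma ZMod.card_filter_prime_pow_mul {p ℓ j : ℕ} [Fact p.Prime] (hj : j ≤ ℓ)
    (P : ZMod (p ^ ℓ) → Prop) [DecidablePred P]
    (hP : ∀ u, P u ↔ ∃ v : ℕ, u = (p : ZMod (p ^ ℓ)) ^ j * v) :
    (Finset.univ.filter P).card = p ^ (ℓ - j) := by
  have := ZMod.card_filter_exists_mul (N := p ^ ℓ) (a := p ^ j) (m := 1) (k := p ^ (ℓ - j))
    (by rw [mul_one, ← pow_add, Nat.add_sub_cancel' hj]) (fun _ => True) P (by simpa using hP)
  simpa using this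

lemma ZMod.prime_pow_isUnit_or {p ℓ : ℕ} [hp : Fact p.Prime] (x : ZMod (p ^ ℓ)) :
    IsUnit x ∨ ∃ v : ℕ, x = (p : ZMod (p ^ ℓ)) * v := by
  by_cases h : p ∣ x.val
  · obtain ⟨v, hv⟩ := h
    right
    refine ⟨v, ?_⟩
    rw [← ZMod.natCast_zmod_val x, hv, Nat.cast_mul]
  · left
    rw [← ZMod.natCast_zmod_val x, ZMod.isUnit_iff_coprime]
    exact ((hp.out.coprime_iff_not_dvd.2 h).symm).pow_right _

lemma ZMod.not_isUnit_prime_mul {p ℓ : ℕ} [hp : Fact p.Prime] (hℓ : 1 ≤ ℓ) (x : ZMod (p ^ ℓ)) :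
    ¬ IsUnit ((p : ZMod (p ^ ℓ)) * x) := by
  intro h
  have h1 := isUnit_of_mul_isUnit_left h
  rw [ZMod.isUnit_iff_coprime, Nat.coprime_pow_right_iff (by omega), Nat.coprime_self] at h1
  exact hp.out.one_lt.ne' h1

lemma ZMod.not_isUnit_prime_pow_iff {p ℓ : ℕ} [Fact p.Prime] (hℓ : 1 ≤ ℓ)
    (x : ZMod (p ^ ℓ)) : ¬ IsUnit x ↔ ∃ v : ℕ, x = (p : ZMod (p ^ ℓ)) * v := by
  constructor
  · exact (ZMod.prime_pow_isUnit_or x).resolve_left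
  · rintro ⟨v, rfl⟩
    exact ZMod.not_isUnit_prime_mul hℓ _

lemma ZMod.eq_prime_pow_mul_iff {p ℓ : ℕ} [Fact p.Prime] {j : ℕ} (hj : j ≤ ℓ)
    (x : ZMod (p ^ ℓ)) :
    (∃ v : ℕ, x = (p : ZMod (p ^ ℓ)) ^ j * v) ↔ p ^ j ∣ x.val := by
  constructor
  · rintro ⟨v, rfl⟩
    rw [← Nat.cast_pow, ← Nat.cast_mul, ZMod.val_natCast,
      Nat.dvd_mod_iff (pow_dvd_pow p hj)]
    exact Dvd.intro _ rfl
  · rintro ⟨v, hv⟩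
    exact ⟨v, by rw [← ZMod.natCast_zmod_val x, hv]; push_cast; rfl⟩

lemma ZMod.prime_mul_eq_zero_iff {p ℓ : ℕ} [hp : Fact p.Prime] (hℓ : 1 ≤ ℓ) (x : ZMod (p ^ ℓ)) :
    (p : ZMod (p ^ ℓ)) * x = 0 ↔ ∃ v : ℕ, x = (p : ZMod (p ^ ℓ)) ^ (ℓ - 1) * v := by
  rw [ZMod.eq_prime_pow_mul_iff (by omega)]
  conv_lhs => rw [← ZMod.natCast_zmod_val x, ← Nat.cast_mul, ZMod.natCast_eq_zero_iff]
  generalize x.val = n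
  obtain ⟨k, rfl⟩ := Nat.exists_eq_add_of_le' hℓ
  rw [pow_succ', Nat.mul_dvd_mul_iff_left hp.out.pos, Nat.add_sub_cancel]

lemma Nat.Prime.pow_dvd_sq_iff {p : ℕ} (hp : p.Prime) (a n : ℕ) :
    p ^ a ∣ n ^ 2 ↔ p ^ ((a + 1) / 2) ∣ n := by
  rcases eq_or_ne n 0 with rfl | hn
  · simp
  · rw [hp.pow_dvd_iff_le_factorization hn, hp.pow_dvd_iff_le_factorization (pow_ne_zero 2 hn),
      Nat.factorization_pow]
    simp only [Finsupp.smul_apply, smul_eq_mul]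
    omega

lemma ZMod.sq_eq_zero_iff_prime_pow {p ℓ : ℕ} [hp : Fact p.Prime] (x : ZMod (p ^ ℓ)) :
    x ^ 2 = 0 ↔ ∃ v : ℕ, x = (p : ZMod (p ^ ℓ)) ^ ((ℓ + 1) / 2) * v := by
  rw [ZMod.eq_prime_pow_mul_iff (by
    rcases ℓ with _ | ℓ
    · simp
    · omega), ← hp.out.pow_dvd_sq_iff]
  conv_lhs => rw [← ZMod.natCast_zmod_val x, ← Nat.cast_pow, ZMod.natCast_eq_zero_iff]

lemma ZMod.prime_mul_sq_eq_zero_iff {p ℓ : ℕ} [hp : Fact p.Prime] (hℓ : 1 ≤ ℓ)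
    (x : ZMod (p ^ ℓ)) :
    (p : ZMod (p ^ ℓ)) * x ^ 2 = 0 ↔ ∃ v : ℕ, x = (p : ZMod (p ^ ℓ)) ^ (ℓ / 2) * v := by
  rw [ZMod.eq_prime_pow_mul_iff (Nat.div_le_self _ _)]
  conv_lhs => rw [← ZMod.natCast_zmod_val x, ← Nat.cast_pow, ← Nat.cast_mul,
    ZMod.natCast_eq_zero_iff]
  generalize x.val = n
  obtain ⟨k, rfl⟩ := Nat.exists_eq_add_of_le' hℓ
  rw [pow_succ', Nat.mul_dvd_mul_iff_left hp.out.pos, hp.out.pow_dvd_sq_iff]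

lemma ZMod.card_not_isUnit_prime_pow {p ℓ : ℕ} [Fact p.Prime] (hℓ : 1 ≤ ℓ)
    [DecidablePred fun x : ZMod (p ^ ℓ) => ¬ IsUnit x] :
    (Finset.univ.filter fun x : ZMod (p ^ ℓ) => ¬ IsUnit x).card = p ^ (ℓ - 1) :=
  ZMod.card_filter_prime_pow_mul hℓ _ (by simpa using ZMod.not_isUnit_prime_pow_iff hℓ)

lemma ZMod.card_isUnit_prime_pow {p ℓ : ℕ} [hp : Fact p.Prime] (hℓ : 1 ≤ ℓ)
    [DecidablePred fun x : ZMod (p ^ ℓ) => IsUnit x] :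
    ((Finset.univ.filter fun x : ZMod (p ^ ℓ) => IsUnit x).card : ℂ)
      = p ^ (ℓ - 1) * (p - 1) := by
  classical
  have h1 := Finset.card_filter_add_card_filter_not (s := Finset.univ)
    (fun x : ZMod (p ^ ℓ) => IsUnit x)
  rw [ZMod.card_not_isUnit_prime_pow hℓ, Finset.card_univ, ZMod.card] at h1
  have h2 : p ^ ℓ = p ^ (ℓ - 1) * p := by rw [← pow_succ, Nat.sub_add_cancel hℓ]
  have h3 := congrArg (Nat.cast (R := ℂ)) (h1.trans h2)
  push_cast at h3
  convert eq_sub_of_add_eq h3 using 1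
  ring

open ZMod in
lemma ramanujanSum_eq_sum_stdAddChar_s5 {q : ℕ} [NeZero q] [DecidablePred (IsUnit (M := ZMod q))]
    (x : ZMod q) :
    ramanujanSum q x = ∑ r : ZMod q with IsUnit r, stdAddChar (r * x) := by
  unfold ramanujanSum
  refine Finset.sum_nbij' (fun r : ℕ => (r : ZMod q)) ZMod.val ?_ ?_ ?_ ?_ ?_
  · intro r hr
    simp only [Finset.mem_filter, Finset.mem_range, Finset.mem_univ, true_and] at hr ⊢
    exact (ZMod.isUnit_iff_coprime _ _).2 hr.2
  · intro r hr
    simp only [Finset.mem_filter, Finset.mem_range, Finset.mem_univ, true_and] at hr ⊢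
    refine ⟨r.val_lt, ?_⟩
    rwa [← ZMod.isUnit_iff_coprime, ZMod.natCast_zmod_val]
  · intro r hr
    simp only [Finset.mem_filter, Finset.mem_range] at hr
    exact ZMod.val_natCast_of_lt hr.1
  · intro r _
    exact ZMod.natCast_zmod_val r
  · intro r _
    have := ZMod.stdAddChar_coe (N := q) ((r * x.val : ℕ) : ℤ)
    rw [Int.cast_natCast, Int.cast_natCast] at this
    rw [← this]
    push_cast
    rw [ZMod.natCast_zmod_val]

/-- The explicit value of the Ramanujan sum modulo a prime power. -/
lemma ramanujanSum_prime_pow {p ℓ : ℕ} [hp : Fact p.Prime] (hℓ : 1 ≤ ℓ) (x : ZMod (p ^ ℓ)) :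
    ramanujanSum (p ^ ℓ) x = (if x = 0 then (p : ℂ) ^ ℓ else 0) -
      (if (p : ZMod (p ^ ℓ)) * x = 0 then (p : ℂ) ^ (ℓ - 1) else 0) := by
  classical
  rw [ramanujanSum_eq_sum_stdAddChar_s5, eq_sub_iff_add_eq]
  have hq : p * p ^ (ℓ - 1) = p ^ ℓ := by rw [← pow_succ', Nat.sub_add_cancel hℓ]
  have h1 := AddChar.sum_mulShift x (ZMod.isPrimitive_stdAddChar (p ^ ℓ))
  rw [ZMod.card, ← Finset.sum_filter_add_sum_filter_not _ (fun r : ZMod (p ^ ℓ) => IsUnit r)] at h1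
  push_cast at h1
  rw [← h1]
  congr 1
  set z : ℂ := ZMod.stdAddChar ((p : ZMod (p ^ ℓ)) * x) with hz
  have h2 : ∑ r : ZMod (p ^ ℓ) with ¬ IsUnit r, (ZMod.stdAddChar (r * x) : ℂ)
      = ∑ v ∈ Finset.range (p ^ (ℓ - 1)), z ^ v := by
    symm
    refine Finset.sum_bij (fun v _ => (p : ZMod (p ^ ℓ)) * v) ?_ ?_ ?_ ?_
    · intro v _
      exact Finset.mem_filter.2 ⟨Finset.mem_univ _, ZMod.not_isUnit_prime_mul hℓ _⟩
    · intro v hv w hw h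
      rw [Finset.mem_range] at hv hw
      rw [← Nat.cast_mul, ← Nat.cast_mul, ZMod.natCast_eq_natCast_iff', ← hq,
        Nat.mul_mod_mul_left, Nat.mul_mod_mul_left, Nat.mod_eq_of_lt hv, Nat.mod_eq_of_lt hw] at h
      exact Nat.eq_of_mul_eq_mul_left hp.out.pos h
    · intro r hr
      simp only [Finset.mem_filter, Finset.mem_univ, true_and] at hr
      obtain ⟨v, rfl⟩ := (ZMod.not_isUnit_prime_pow_iff hℓ r).1 hr
      refine ⟨v % p ^ (ℓ - 1), Finset.mem_range.2 (Nat.mod_lt _ (pow_pos hp.out.pos _)), ?_⟩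
      rw [← Nat.cast_mul, ← Nat.cast_mul, ← Nat.mul_mod_mul_left, hq, ZMod.natCast_mod]
    · intro v _
      rw [hz, ← AddChar.map_nsmul_eq_pow, nsmul_eq_mul]
      congr 1
      ring
  rw [h2]
  split_ifs with h
  · simp [hz, h]
  · have hz1 : z - 1 ≠ 0 := by
      rw [sub_ne_zero, hz, ← AddChar.map_zero_eq_one (ZMod.stdAddChar (N := p ^ ℓ))]
      exact fun h' => h (ZMod.injective_stdAddChar h')
    have hz2 : z ^ (p ^ (ℓ - 1)) = 1 := by
      rw [hz, ← AddChar.map_nsmul_eq_pow, nsmul_eq_mul, ← mul_assoc, ← Nat.cast_mul, mul_comm _ p,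
        hq, ZMod.natCast_self, zero_mul, AddChar.map_zero_eq_one]
    have h3 := mul_geom_sum z (p ^ (ℓ - 1))
    rw [hz2, sub_self] at h3
    exact ((mul_eq_zero.1 h3).resolve_left hz1).symm

lemma sum_ramanujanSum_mul_add {q : ℕ} [NeZero q] (y : ZMod q) :
    ∑ b : ZMod q, ∑ c : ZMod q, ramanujanSum q (y - b * c) = q * ramanujanSum q y := by
  classical
  have h : ∀ r : ZMod q, IsUnit r →
      ∑ b : ZMod q, ∑ c : ZMod q, (ZMod.stdAddChar (r * (y - b * c)) : ℂ)
        = q * ZMod.stdAddChar (r * y) := by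
    intro r hr
    have h1 : ∀ b : ZMod q, ∑ c : ZMod q, (ZMod.stdAddChar (r * (y - b * c)) : ℂ)
        = if b = 0 then (q : ℂ) * ZMod.stdAddChar (r * y) else 0 := by
      intro b
      have h2 := AddChar.sum_mulShift (-(r * b)) (ZMod.isPrimitive_stdAddChar q)
      simp only [ZMod.card, neg_eq_zero, hr.mul_right_eq_zero] at h2
      calc _ = ∑ c : ZMod q, (ZMod.stdAddChar (r * y) : ℂ) * ZMod.stdAddChar (c * -(r * b)) := by
            refine Finset.sum_congr rfl fun c _ => ?_
            rw [← AddChar.map_add_eq_mul]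
            congr 1
            ring
        _ = _ := by
            rw [← Finset.mul_sum, h2]
            split_ifs <;> simp [mul_comm]
    simp only [h1, Finset.sum_ite_eq', Finset.mem_univ, if_true]
  simp only [ramanujanSum_eq_sum_stdAddChar_s5]
  rw [Finset.mul_sum, Finset.sum_congr rfl fun b _ => Finset.sum_comm, Finset.sum_comm]
  exact Finset.sum_congr rfl fun r hr => h r (Finset.mem_filter.1 hr).2

open Matrix in
lemma card_specialLinearGroup_prime_pow {p ℓ : ℕ} [hp : Fact p.Prime] (hℓ : 1 ≤ ℓ) :
    (Fintype.card (SpecialLinearGroup (Fin 2) (ZMod (p ^ ℓ))) : ℂ)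
      = ((p : ℂ) ^ (ℓ - 1)) ^ 3 * p * ((p : ℂ) ^ 2 - 1) := by
  classical
  set R := ZMod (p ^ ℓ) with hR
  have hdet : ∀ γ : SpecialLinearGroup (Fin 2) R, γ.1 0 0 * γ.1 1 1 - γ.1 0 1 * γ.1 1 0 = 1 :=
    fun γ => by rw [← det_fin_two]; exact γ.2
  have hunit : (Finset.univ.filter fun γ : SpecialLinearGroup (Fin 2) R => IsUnit (γ.1 0 0)).card
      = ((Finset.univ.filter fun x : R => IsUnit x) ×ˢ
          (Finset.univ : Finset (R × R))).card := by
    refine Finset.card_bij (fun γ _ => (γ.1 0 0, γ.1 0 1, γ.1 1 0)) ?_ ?_ ?_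
    · intro γ h
      simpa using h
    · intro γ h γ' h' he
      simp only [Finset.mem_filter, Finset.mem_univ, true_and] at h
      simp only [Prod.mk.injEq] at he
      obtain ⟨e1, e2, e3⟩ := he
      have e4 : γ.1 1 1 = γ'.1 1 1 := by
        refine h.mul_left_cancel ?_
        have h1 := hdet γ
        have h2 := hdet γ'
        rw [← e1, ← e2, ← e3] at h2
        linear_combination h1 - h2
      ext i j
      fin_cases i <;> fin_cases j <;> assumption
    · rintro ⟨a, b, c⟩ h
      simp only [Finset.mem_product, Finset.mem_filter, Finset.mem_univ, true_and, and_true] at h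
      obtain ⟨a', ha'⟩ := h.exists_right_inv
      refine ⟨⟨!![a, b; c, a' * (1 + b * c)], ?_⟩, ?_, ?_⟩
      · rw [det_fin_two_of]
        linear_combination (1 + b * c) * ha'
      · exact Finset.mem_filter.2 ⟨Finset.mem_univ _, h⟩
      · simp
  have hnon : (Finset.univ.filter fun γ : SpecialLinearGroup (Fin 2) R => ¬ IsUnit (γ.1 0 0)).card
      = ((Finset.univ.filter fun x : R => ¬ IsUnit x) ×ˢ
          ((Finset.univ.filter fun x : R => IsUnit x) ×ˢ (Finset.univ : Finset R))).card := by
    have hb : ∀ γ : SpecialLinearGroup (Fin 2) R, ¬ IsUnit (γ.1 0 0) → IsUnit (γ.1 0 1) := by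
      intro γ h
      by_contra h'
      obtain ⟨v, hv⟩ := (ZMod.not_isUnit_prime_pow_iff hℓ _).1 h
      obtain ⟨w, hw⟩ := (ZMod.not_isUnit_prime_pow_iff hℓ _).1 h'
      refine ZMod.not_isUnit_prime_mul hℓ ((v : R) * γ.1 1 1 - (w : R) * γ.1 1 0) ?_
      have h1 := hdet γ
      rw [hv, hw] at h1
      convert isUnit_one
      linear_combination h1
    refine Finset.card_bij (fun γ _ => (γ.1 0 0, γ.1 0 1, γ.1 1 1)) ?_ ?_ ?_
    · intro γ h
      simp only [Finset.mem_filter, Finset.mem_univ, true_and] at h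
      simpa using ⟨h, hb γ h⟩
    · intro γ h γ' h' he
      simp only [Finset.mem_filter, Finset.mem_univ, true_and] at h
      simp only [Prod.mk.injEq] at he
      obtain ⟨e1, e2, e4⟩ := he
      have e3 : γ.1 1 0 = γ'.1 1 0 := by
        refine (hb γ h).mul_left_cancel ?_
        have h1 := hdet γ
        have h2 := hdet γ'
        rw [← e1, ← e2, ← e4] at h2
        linear_combination h2 - h1
      ext i j
      fin_cases i <;> fin_cases j <;> assumption
    · rintro ⟨a, b, d⟩ h
      simp only [Finset.mem_product, Finset.mem_filter, Finset.mem_univ, true_and, and_true] at h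
      obtain ⟨b', hb'⟩ := h.2.exists_right_inv
      refine ⟨⟨!![a, b; b' * (a * d - 1), d], ?_⟩, ?_, ?_⟩
      · rw [det_fin_two_of]
        linear_combination (1 - a * d) * hb'
      · exact Finset.mem_filter.2 ⟨Finset.mem_univ _, h.1⟩
      · simp
  rw [← Finset.card_univ, ← Finset.card_filter_add_card_filter_not (s := Finset.univ)
    (fun γ : SpecialLinearGroup (Fin 2) R => IsUnit (γ.1 0 0)), hunit, hnon]
  simp only [Finset.card_product, Finset.card_univ, Fintype.card_prod]
  push_cast
  rw [ZMod.card_isUnit_prime_pow hℓ, ZMod.card_not_isUnit_prime_pow hℓ, ZMod.card]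
  have h2 : (p : ℂ) ^ ℓ = p ^ (ℓ - 1) * p := by rw [← pow_succ, Nat.sub_add_cancel hℓ]
  push_cast
  rw [h2]
  ring

/-- The number of points of the affine quadric `u ^ 2 - b * c = D` over a finite ring. -/
def quadricCard {R : Type*} [CommRing R] [Fintype R] [DecidableEq R] (D : R) : ℕ :=
  (Finset.univ.filter fun t : R × R × R => t.1 ^ 2 - t.2.1 * t.2.2 = D).card

section Quadric

variable {R : Type*} [CommRing R] [Fintype R] [DecidableEq R]

lemma quadricCard_sq_mul {t : R} (ht : IsUnit t) (D : R) :
    quadricCard (t ^ 2 * D) = quadricCard D := by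
  symm
  refine Finset.card_bij (fun x _ => (t * x.1, t ^ 2 * x.2.1, x.2.2)) ?_ ?_ ?_
  · rintro ⟨u, b, c⟩ h
    simp only [Finset.mem_filter, Finset.mem_univ, true_and] at h ⊢
    rw [← h]
    ring
  · rintro ⟨u, b, c⟩ _ ⟨u', b', c'⟩ _ h
    simpa [ht.mul_right_inj, (ht.pow 2).mul_right_inj] using h
  · rintro ⟨u, b, c⟩ h
    obtain ⟨s, hs⟩ := ht.exists_right_inv
    simp only [Finset.mem_filter, Finset.mem_univ, true_and] at h
    have hs2 : t ^ 2 * s ^ 2 = 1 := by rw [← mul_pow, hs, one_pow]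
    refine ⟨(s * u, s ^ 2 * b, c), ?_, ?_⟩
    · simp only [Finset.mem_filter, Finset.mem_univ, true_and]
      linear_combination s ^ 2 * h + D * hs2
    · simp [← mul_assoc, hs, hs2]

open Matrix in
/-- Matrices of determinant one on which a diagonal linear form takes a prescribed value are
in bijection with the points of an affine quadric. -/
lemma card_specialLinearGroup_linear_eq {δ : R} (h2 : IsUnit (2 : R)) (hδ : IsUnit δ) (m : R) :
    (Finset.univ.filter fun γ : SpecialLinearGroup (Fin 2) R =>
      γ.1 0 0 + δ * γ.1 1 1 = m).card = quadricCard (m ^ 2 - 4 * δ) := by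
  have hdet : ∀ γ : SpecialLinearGroup (Fin 2) R, γ.1 0 0 * γ.1 1 1 - γ.1 0 1 * γ.1 1 0 = 1 :=
    fun γ => by rw [← det_fin_two]; exact γ.2
  have h4 : IsUnit (4 * δ) := by
    have : (4 : R) = 2 * 2 := by norm_num
    rw [this]
    exact (h2.mul h2).mul hδ
  refine Finset.card_bij
    (fun γ _ => (δ * γ.1 1 1 - γ.1 0 0, -(4 * δ) * γ.1 0 1, γ.1 1 0)) ?_ ?_ ?_
  · intro γ h
    simp only [Finset.mem_filter, Finset.mem_univ, true_and] at h ⊢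
    rw [← h]
    linear_combination (-4 * δ) * hdet γ
  · intro γ h γ' h' he
    simp only [Finset.mem_filter, Finset.mem_univ, true_and] at h h'
    simp only [Prod.mk.injEq] at he
    obtain ⟨e1, e2, e3⟩ := he
    have ea : γ.1 0 0 = γ'.1 0 0 := h2.mul_left_cancel (by linear_combination h - h' - e1)
    have ed : γ.1 1 1 = γ'.1 1 1 :=
      (h2.mul hδ).mul_left_cancel (by linear_combination h - h' + e1)
    have eb : γ.1 0 1 = γ'.1 0 1 := h4.neg.mul_left_cancel e2
    ext i j
    fin_cases i <;> fin_cases j <;> assumption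
  · rintro ⟨u, b, c⟩ h
    simp only [Finset.mem_filter, Finset.mem_univ, true_and] at h
    obtain ⟨i, hi⟩ := h2.exists_right_inv
    obtain ⟨e, he⟩ := hδ.exists_right_inv
    have hi4 : 4 * i ^ 2 = 1 := by linear_combination (2 * i + 1) * hi
    refine ⟨⟨!![i * (m - u), -(i ^ 2 * e * b); c, i * e * (m + u)], ?_⟩, ?_, ?_⟩
    · rw [det_fin_two_of]
      linear_combination (-(i ^ 2 * e)) * h + 4 * i ^ 2 * he + hi4
    · refine Finset.mem_filter.2 ⟨Finset.mem_univ _, ?_⟩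
      simp only [of_apply, cons_val', cons_val_zero, cons_val_one, cons_val_fin_one]
      linear_combination (i * (m + u)) * he + m * hi
    · simp only [of_apply, cons_val', cons_val_zero, cons_val_one, cons_val_fin_one,
        Prod.mk.injEq, and_true]
      constructor
      · linear_combination (i * (m + u)) * he + u * hi
      · linear_combination (4 * i ^ 2 * b) * he + b * hi4

end Quadric

section PrimePower

variable {p ℓ : ℕ} [hp : Fact p.Prime]

lemma ramanujanSum_eq_zero_of_prime_mul_ne_zero (hℓ : 1 ≤ ℓ) {x : ZMod (p ^ ℓ)}
    (hx : (p : ZMod (p ^ ℓ)) * x ≠ 0) : ramanujanSum (p ^ ℓ) x = 0 := by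
  rw [ramanujanSum_prime_pow hℓ, if_neg hx, if_neg, sub_zero]
  rintro rfl
  simp at hx

lemma ramanujanSum_isUnit_mul (hℓ : 1 ≤ ℓ) {w : ZMod (p ^ ℓ)} (hw : IsUnit w)
    (x : ZMod (p ^ ℓ)) : ramanujanSum (p ^ ℓ) (w * x) = ramanujanSum (p ^ ℓ) x := by
  rw [ramanujanSum_prime_pow hℓ, ramanujanSum_prime_pow hℓ]
  simp only [mul_left_comm (p : ZMod (p ^ ℓ)) w x, hw.mul_right_eq_zero]

lemma sum_ramanujanSum_prime_pow (hℓ : 1 ≤ ℓ) : ∑ x, ramanujanSum (p ^ ℓ) x = 0 := by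
  have h1 : (Finset.univ.filter fun x : ZMod (p ^ ℓ) => (p : ZMod (p ^ ℓ)) * x = 0).card
      = p ^ (ℓ - (ℓ - 1)) :=
    ZMod.card_filter_prime_pow_mul (by omega) _ (ZMod.prime_mul_eq_zero_iff hℓ)
  simp only [ramanujanSum_prime_pow hℓ, Finset.sum_sub_distrib, ← Finset.sum_filter,
    Finset.sum_const, h1]
  rw [Finset.filter_eq' Finset.univ (0 : ZMod (p ^ ℓ)), if_pos (Finset.mem_univ _),
    Finset.card_singleton, one_smul, nsmul_eq_mul, Nat.cast_pow, ← pow_add,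
    show ℓ - (ℓ - 1) + (ℓ - 1) = ℓ by omega, sub_self]

/-- The quadric count does not change when a number of `p`-adic valuation at most `ℓ - 2` is
perturbed by a multiple of `p ^ (ℓ - 1)`. -/
lemma quadricCard_add_eq (hp2 : p ≠ 2) {L : ℕ} (hL : L + 2 ≤ ℓ) {D₀ : ZMod (p ^ ℓ)}
    (hD₀ : IsUnit D₀) {y : ZMod (p ^ ℓ)} (hy : (p : ZMod (p ^ ℓ)) * y = 0) :
    quadricCard ((p : ZMod (p ^ ℓ)) ^ L * D₀ + y)
      = quadricCard ((p : ZMod (p ^ ℓ)) ^ L * D₀) := by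
  obtain ⟨v, rfl⟩ := (ZMod.prime_mul_eq_zero_iff (by omega) y).1 hy
  obtain ⟨k, rfl⟩ := Nat.exists_eq_add_of_le hL
  have h2 : IsUnit (2 : ZMod (p ^ (L + 2 + k))) := by
    rw [show (2 : ZMod (p ^ (L + 2 + k))) = ((2 : ℕ) : ZMod _) by norm_num,
      ZMod.isUnit_iff_coprime]
    exact (((Nat.coprime_primes hp.out Nat.prime_two).2 hp2).symm).pow_right _
  obtain ⟨e, he⟩ := (h2.mul hD₀).exists_right_inv
  set P : ZMod (p ^ (L + 2 + k)) := (p : ZMod (p ^ (L + 2 + k))) with hP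
  set V : ZMod (p ^ (L + 2 + k)) := (v : ZMod (p ^ (L + 2 + k)))
  have hP0 : P ^ (L + 2 + k) = 0 := by rw [hP, ← Nat.cast_pow, ZMod.natCast_self]
  have ht : IsUnit (1 + P ^ (k + 1) * (e * V)) := by
    rcases ZMod.prime_pow_isUnit_or (1 + P ^ (k + 1) * (e * V)) with h | ⟨w, hw⟩
    · exact h
    · refine absurd ?_ (ZMod.not_isUnit_prime_mul (p := p) (ℓ := L + 2 + k) (by omega)
        ((w : ZMod (p ^ (L + 2 + k))) - P ^ k * (e * V)))
      convert isUnit_one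
      linear_combination -hw
  rw [← quadricCard_sq_mul ht (P ^ L * D₀), show L + 2 + k - 1 = L + k + 1 by omega]
  congr 1
  linear_combination (-(P ^ (L + k + 1) * V)) * he - (P ^ k * (e * V) ^ 2 * D₀) * hP0

lemma sum_ramanujanSum_specialLinearGroup {δ : ZMod (p ^ ℓ)} (h2 : IsUnit (2 : ZMod (p ^ ℓ)))
    (hδ : IsUnit δ) (m : ZMod (p ^ ℓ)) :
    ∑ γ : Matrix.SpecialLinearGroup (Fin 2) (ZMod (p ^ ℓ)),
      ramanujanSum (p ^ ℓ) (γ.1 0 0 + δ * γ.1 1 1 - m)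
      = ∑ x, quadricCard ((m + x) ^ 2 - 4 * δ) * ramanujanSum (p ^ ℓ) x := by
  rw [← Finset.sum_fiberwise_of_maps_to (t := Finset.univ)
    (g := fun γ : Matrix.SpecialLinearGroup (Fin 2) (ZMod (p ^ ℓ)) =>
      γ.1 0 0 + δ * γ.1 1 1 - m) (fun _ _ => Finset.mem_univ _)]
  refine Finset.sum_congr rfl fun x _ => ?_
  rw [← card_specialLinearGroup_linear_eq h2 hδ, Finset.sum_congr rfl fun γ hγ => by
    rw [(Finset.mem_filter.1 hγ).2], Finset.sum_const, nsmul_eq_mul]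
  simp only [sub_eq_iff_eq_add']

lemma add_sq_sub_eq_of_prime_mul_eq_zero (hℓ : 2 ≤ ℓ) {x : ZMod (p ^ ℓ)}
    (hx : (p : ZMod (p ^ ℓ)) * x = 0) (m δ : ZMod (p ^ ℓ)) :
    (m + x) ^ 2 - 4 * δ = m ^ 2 - 4 * δ + 2 * m * x := by
  obtain ⟨v, hv⟩ := (ZMod.prime_mul_eq_zero_iff (by omega) x).1 hx
  obtain ⟨k, rfl⟩ := Nat.exists_eq_add_of_le' hℓ
  have hxx : x * x = 0 := by
    have hv' : x = (p : ZMod (p ^ (k + 2))) ^ (k + 1) * v := hv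
    linear_combination x * hv' + ((p : ZMod (p ^ (k + 2))) ^ k * v) * hx
  linear_combination hxx

lemma sum_ramanujanSum_eq_zero_of_valuation_le (hp2 : p ≠ 2) {L : ℕ} (hL : L + 2 ≤ ℓ)
    {D₀ : ZMod (p ^ ℓ)} (hD₀ : IsUnit D₀) {m δ : ZMod (p ^ ℓ)}
    (hD : m ^ 2 - 4 * δ = (p : ZMod (p ^ ℓ)) ^ L * D₀) :
    ∑ x, quadricCard ((m + x) ^ 2 - 4 * δ) * ramanujanSum (p ^ ℓ) x = 0 := by
  calc _ = ∑ x, (quadricCard (m ^ 2 - 4 * δ) : ℂ) * ramanujanSum (p ^ ℓ) x := by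
        refine Finset.sum_congr rfl fun x _ => ?_
        by_cases hx : (p : ZMod (p ^ ℓ)) * x = 0
        · rw [add_sq_sub_eq_of_prime_mul_eq_zero (by omega) hx, hD,
            quadricCard_add_eq hp2 hL hD₀ (by rw [mul_left_comm, hx, mul_zero])]
        · rw [ramanujanSum_eq_zero_of_prime_mul_ne_zero (by omega) hx, mul_zero, mul_zero]
    _ = 0 := by rw [← Finset.mul_sum, sum_ramanujanSum_prime_pow (by omega), mul_zero]

lemma sum_ramanujanSum_eq_sum_sq_sub (hℓ : 2 ≤ ℓ) {m : ZMod (p ^ ℓ)} (δ : ZMod (p ^ ℓ))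
    (hm : IsUnit (2 * m)) :
    ∑ x, quadricCard ((m + x) ^ 2 - 4 * δ) * ramanujanSum (p ^ ℓ) x
      = (p : ℂ) ^ ℓ * ∑ u, ramanujanSum (p ^ ℓ) (u ^ 2 - (m ^ 2 - 4 * δ)) := by
  set D := m ^ 2 - 4 * δ with hD
  obtain ⟨w, hw⟩ := hm
  calc _ = ∑ x, quadricCard (D + w * x) * ramanujanSum (p ^ ℓ) (w * x) := by
        refine Finset.sum_congr rfl fun x _ => ?_
        rw [ramanujanSum_isUnit_mul (by omega) w.isUnit]
        by_cases hx : (p : ZMod (p ^ ℓ)) * x = 0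
        · rw [add_sq_sub_eq_of_prime_mul_eq_zero hℓ hx, hw]
        · rw [ramanujanSum_eq_zero_of_prime_mul_ne_zero (by omega) hx, mul_zero, mul_zero]
    _ = ∑ y, quadricCard (D + y) * ramanujanSum (p ^ ℓ) y :=
        Fintype.sum_equiv w.mulLeft _ _ fun x => rfl
    _ = ∑ t : ZMod (p ^ ℓ) × ZMod (p ^ ℓ) × ZMod (p ^ ℓ),
          ramanujanSum (p ^ ℓ) (t.1 ^ 2 - t.2.1 * t.2.2 - D) := by
        rw [← Finset.sum_fiberwise_of_maps_to (t := Finset.univ)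
          (g := fun t : ZMod (p ^ ℓ) × ZMod (p ^ ℓ) × ZMod (p ^ ℓ) =>
            t.1 ^ 2 - t.2.1 * t.2.2 - D) (fun _ _ => Finset.mem_univ _)]
        refine Finset.sum_congr rfl fun y _ => ?_
        rw [Finset.sum_congr rfl fun t ht => by
          rw [(Finset.mem_filter.1 ht).2], Finset.sum_const, nsmul_eq_mul, quadricCard]
        simp only [sub_eq_iff_eq_add (b := D), add_comm y D]
    _ = _ := by
        rw [Fintype.sum_prod_type, Finset.mul_sum]
        refine Finset.sum_congr rfl fun u _ => ?_
        rw [Fintype.sum_prod_type, ← Nat.cast_pow, ← sum_ramanujanSum_mul_add]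
        simp only [sub_right_comm]

lemma sum_ramanujanSum_sq_sub (hℓ : 1 ≤ ℓ) {D : ZMod (p ^ ℓ)}
    (hD : (p : ZMod (p ^ ℓ)) * D = 0) :
    ∑ u, ramanujanSum (p ^ ℓ) (u ^ 2 - D)
      = (p : ℂ) ^ ℓ * (Finset.univ.filter fun u : ZMod (p ^ ℓ) => u ^ 2 = D).card
        - (p : ℂ) ^ (ℓ - 1) * (p : ℂ) ^ (ℓ - ℓ / 2) := by
  have h1 : (Finset.univ.filter fun u : ZMod (p ^ ℓ) => (p : ZMod (p ^ ℓ)) * u ^ 2 = 0).card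
      = p ^ (ℓ - ℓ / 2) :=
    ZMod.card_filter_prime_pow_mul (Nat.div_le_self _ _) _ (ZMod.prime_mul_sq_eq_zero_iff hℓ)
  simp only [ramanujanSum_prime_pow hℓ, mul_sub, hD, sub_zero, sub_eq_zero (b := D),
    Finset.sum_sub_distrib, ← Finset.sum_filter, Finset.sum_const, h1, nsmul_eq_mul]
  push_cast
  ring

lemma card_sq_eq_zero_prime_pow (p ℓ : ℕ) [Fact p.Prime] :
    (Finset.univ.filter fun u : ZMod (p ^ ℓ) => u ^ 2 = 0).card = p ^ (ℓ / 2) := by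
  rw [ZMod.card_filter_prime_pow_mul (j := (ℓ + 1) / 2) (by omega) _
    ZMod.sq_eq_zero_iff_prime_pow, show ℓ - (ℓ + 1) / 2 = ℓ / 2 by omega]

lemma card_sq_eq_prime_pow_odd_mul {k : ℕ} (hk : 1 ≤ k) {d : ℤ} (hd : ¬ (p : ℤ) ∣ d) :
    (Finset.univ.filter fun u : ZMod (p ^ (2 * k)) => u ^ 2 = p ^ (2 * k - 1) * d).card = 0 := by
  rw [Finset.card_eq_zero, Finset.filter_eq_empty_iff]
  intro u _ hu
  have hP : (p : ZMod (p ^ (2 * k))) ^ (2 * k) = 0 := by rw [← Nat.cast_pow, ZMod.natCast_self]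
  have hpp : (p : ZMod (p ^ (2 * k))) * p ^ (2 * k - 1) = 0 := by
    rw [← pow_succ', Nat.sub_add_cancel (by omega), hP]
  obtain ⟨v, rfl⟩ := (ZMod.prime_mul_sq_eq_zero_iff (by omega) u).1
    (by rw [hu, ← mul_assoc, hpp, zero_mul])
  rw [mul_pow, ← pow_mul, show 2 * k / 2 * 2 = 2 * k by omega, hP, zero_mul] at hu
  have h1 : (((p : ℤ) ^ (2 * k - 1) * d : ℤ) : ZMod (p ^ (2 * k))) = 0 := by
    push_cast
    exact hu.symm
  rw [ZMod.intCast_zmod_eq_zero_iff_dvd, Nat.cast_pow] at h1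
  rw [show (p : ℤ) ^ (2 * k) = p ^ (2 * k - 1) * p by
    rw [← pow_succ, Nat.sub_add_cancel (by omega)]] at h1
  exact hd ((mul_dvd_mul_iff_left (pow_ne_zero _ (by exact_mod_cast hp.out.ne_zero))).1 h1)

lemma card_sq_eq_prime_pow_even_mul (hp2 : p ≠ 2) (k : ℕ) (d : ℤ) :
    ((Finset.univ.filter fun u : ZMod (p ^ (2 * k + 1)) => u ^ 2 = p ^ (2 * k) * d).card : ℂ)
      = p ^ k * (legendreSym p d + 1) := by
  have h1 : (Finset.univ.filter fun u : ZMod (p ^ (2 * k + 1)) => u ^ 2 = p ^ (2 * k) * d).card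
      = p ^ k * (Finset.univ.filter fun v : ZMod p => v ^ 2 = d).card := by
    refine ZMod.card_filter_exists_mul (a := p ^ k) (by ring) _ _ fun u => ?_
    have key : ∀ v : ℕ, ((p : ZMod (p ^ (2 * k + 1))) ^ k * v) ^ 2 = p ^ (2 * k) * d
        ↔ (v : ZMod p) ^ 2 = d := by
      intro v
      have e1 : ((p : ZMod (p ^ (2 * k + 1))) ^ k * v) ^ 2 - p ^ (2 * k) * d
          = (((p : ℤ) ^ (2 * k) * ((v : ℤ) ^ 2 - d) : ℤ) : ZMod (p ^ (2 * k + 1))) := by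
        push_cast
        ring
      have e2 : (v : ZMod p) ^ 2 - d = (((v : ℤ) ^ 2 - d : ℤ) : ZMod p) := by push_cast; ring
      rw [← sub_eq_zero, e1, ← sub_eq_zero (b := (d : ZMod p)), e2,
        ZMod.intCast_zmod_eq_zero_iff_dvd, ZMod.intCast_zmod_eq_zero_iff_dvd, Nat.cast_pow,
        pow_succ, mul_dvd_mul_iff_left (pow_ne_zero _ (by exact_mod_cast hp.out.ne_zero))]
    constructor
    · intro hu
      have hP : (p : ZMod (p ^ (2 * k + 1))) * p ^ (2 * k) = 0 := by
        rw [← pow_succ', ← Nat.cast_pow, ZMod.natCast_self]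
      obtain ⟨v, rfl⟩ := (ZMod.prime_mul_sq_eq_zero_iff (by omega) u).1
        (by rw [hu, ← mul_assoc, hP, zero_mul])
      rw [show (2 * k + 1) / 2 = k by omega] at hu ⊢
      exact ⟨v, by push_cast; rfl, (key v).1 hu⟩
    · rintro ⟨v, rfl, hv⟩
      rw [Nat.cast_pow]
      exact (key v).2 hv
  have h2 := legendreSym.card_sqrts p hp2 d
  rw [Set.toFinset_ofPred] at h2
  have h3 := congrArg (Int.cast (R := ℂ)) h2
  push_cast at h3
  rw [h1]
  push_cast
  rw [h3]

end PrimePower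

/-- Evaluation of the local singular series at powers `p^ℓ` (`ℓ ≥ 2`) of an odd prime
`p ∤ Δ`, in terms of the `p`-adic valuation `L` of `n² − 4Δ`. -/
theorem singSeries_primePow_delta_ne_zero (p : ℕ) [Fact p.Prime] (hodd : Odd p) (Δ : ℤ)
    (hΔ : ¬ (p : ℤ) ∣ Δ) (ℓ : ℕ) (hℓ : 2 ≤ ℓ) (n : ℤ) (hn : n ^ 2 ≠ 4 * Δ)
    (L : ℕ) (hL : L = padicValInt p (n ^ 2 - 4 * Δ))
    (S : ℂ)
    (hS : S = (Fintype.card (Matrix.SpecialLinearGroup (Fin 2) (ZMod (p ^ ℓ))) : ℂ)⁻¹ *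
      ∑ γ : Matrix.SpecialLinearGroup (Fin 2) (ZMod (p ^ ℓ)),
        ramanujanSum (p ^ ℓ)
          (γ.1 0 0 + (Δ : ZMod (p ^ ℓ)) * γ.1 1 1 - (n : ZMod (p ^ ℓ)))) :
    ((L ≤ ℓ - 2 ∨ (Odd ℓ ∧ ℓ ≤ L)) → S = 0) ∧
    (Odd ℓ → L = ℓ - 1 →
      S = (legendreSym p ((n ^ 2 - 4 * Δ) / (p : ℤ) ^ L) : ℂ) *
            ((p : ℂ) ^ ((ℓ - 3) / 2))⁻¹ / ((p : ℂ) ^ 2 - 1)) ∧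
    (Even ℓ → ℓ ≤ L → S = ((p : ℂ) ^ ((ℓ - 2) / 2))⁻¹ / ((p : ℂ) + 1)) ∧
    (Even ℓ → L = ℓ - 1 → S = -((p : ℂ) ^ ((ℓ - 2) / 2))⁻¹ / ((p : ℂ) ^ 2 - 1)) := by
  have hp : p.Prime := Fact.out
  have hp2 : p ≠ 2 := by
    rintro rfl
    exact absurd hodd (by decide)
  have hpC : (p : ℂ) ≠ 0 := by exact_mod_cast hp.ne_zero
  have hpZ : (p : ℤ) ≠ 0 := by exact_mod_cast hp.ne_zero
  have hp1 : (p : ℂ) - 1 ≠ 0 := sub_ne_zero.2 (by exact_mod_cast hp.one_lt.ne')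
  have hp1' : (p : ℂ) + 1 ≠ 0 := by exact_mod_cast Nat.succ_ne_zero p
  have hpsq : (p : ℂ) ^ 2 - 1 ≠ 0 := by
    rw [show (p : ℂ) ^ 2 - 1 = (p - 1) * (p + 1) by ring]
    exact mul_ne_zero hp1 hp1'
  have hunit : ∀ z : ℤ, ¬ (p : ℤ) ∣ z → IsUnit (z : ZMod (p ^ ℓ)) := by
    intro z hz
    rw [ZMod.coe_int_isUnit_iff_isCoprime, Nat.cast_pow]
    exact ((Nat.prime_iff_prime_int.1 hp).coprime_iff_not_dvd.2 hz).pow_left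
  have h2Z : ¬ (p : ℤ) ∣ 2 := by
    intro h
    exact hp2 ((Nat.prime_dvd_prime_iff_eq hp Nat.prime_two).1 (by exact_mod_cast h))
  have h2 : IsUnit (2 : ZMod (p ^ ℓ)) := by exact_mod_cast hunit 2 h2Z
  have hD0 : n ^ 2 - 4 * Δ ≠ 0 := sub_ne_zero.2 hn
  obtain ⟨d, hd⟩ : (p : ℤ) ^ L ∣ n ^ 2 - 4 * Δ := by
    rw [hL]
    exact padicValInt_dvd _
  have hpd : ¬ (p : ℤ) ∣ d := by
    rintro ⟨e, rfl⟩
    have h := (padicValInt_dvd_iff (p := p) (L + 1) (n ^ 2 - 4 * Δ)).1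
      ⟨e, by rw [hd]; ring⟩
    rcases h with h | h
    · exact hD0 h
    · omega
  have hdiv : (n ^ 2 - 4 * Δ) / (p : ℤ) ^ L = d := by
    rw [hd, Int.mul_ediv_cancel_left _ (pow_ne_zero _ hpZ)]
  have hDR : (n : ZMod (p ^ ℓ)) ^ 2 - 4 * (Δ : ZMod (p ^ ℓ)) = (p : ZMod (p ^ ℓ)) ^ L * d := by
    have := congrArg (Int.cast (R := ZMod (p ^ ℓ))) hd
    push_cast at this
    exact this
  rw [sum_ramanujanSum_specialLinearGroup h2 (hunit Δ hΔ),
    card_specialLinearGroup_prime_pow (by omega)] at hS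
  have hlarge : ℓ - 1 ≤ L → S = (((p : ℂ) ^ (ℓ - 1)) ^ 3 * p * ((p : ℂ) ^ 2 - 1))⁻¹ *
      ((p : ℂ) ^ ℓ * ((p : ℂ) ^ ℓ * (Finset.univ.filter fun u : ZMod (p ^ ℓ) =>
        u ^ 2 = (p : ZMod (p ^ ℓ)) ^ L * d).card - (p : ℂ) ^ (ℓ - 1) * (p : ℂ) ^ (ℓ - ℓ / 2))) := by
    intro h
    have hpn : ¬ (p : ℤ) ∣ n := by
      intro hn'
      have h1 : (p : ℤ) ∣ n ^ 2 - 4 * Δ := by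
        rw [hd]
        exact (dvd_pow_self _ (by omega)).mul_right _
      have h3 : (p : ℤ) ∣ 2 * (2 * Δ) := by
        have := dvd_sub (dvd_pow hn' two_ne_zero) h1
        rwa [show n ^ 2 - (n ^ 2 - 4 * Δ) = 2 * (2 * Δ) by ring] at this
      have hpp := Nat.prime_iff_prime_int.1 hp
      exact (((hpp.dvd_or_dvd h3).resolve_left h2Z |> hpp.dvd_or_dvd).resolve_left h2Z |> hΔ)
    have hpD : (p : ZMod (p ^ ℓ)) * (p ^ L * d) = 0 := by
      obtain ⟨j, rfl⟩ := Nat.exists_eq_add_of_le h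
      have h1 : (p : ZMod (p ^ ℓ)) ^ ℓ = 0 := by rw [← Nat.cast_pow, ZMod.natCast_self]
      rw [← mul_assoc, ← pow_succ', show ℓ - 1 + j + 1 = ℓ + j by omega, pow_add, h1, zero_mul,
        zero_mul]
    rw [hS, sum_ramanujanSum_eq_sum_sq_sub hℓ _ (h2.mul (hunit n hpn)), hDR,
      sum_ramanujanSum_sq_sub (by omega) hpD]
  have hzero : ℓ ≤ L → (p : ZMod (p ^ ℓ)) ^ L * (d : ZMod (p ^ ℓ)) = 0 := by
    intro h
    have h1 : (p : ZMod (p ^ ℓ)) ^ ℓ = 0 := by rw [← Nat.cast_pow, ZMod.natCast_self]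
    rw [← Nat.add_sub_cancel' h, pow_add, h1, zero_mul, zero_mul]
  refine ⟨?_, ?_, ?_, ?_⟩
  · rintro (h | ⟨⟨k, hk⟩, h⟩)
    · rw [hS, sum_ramanujanSum_eq_zero_of_valuation_le hp2 (by omega) (hunit d hpd) hDR, mul_zero]
    · rw [hlarge (by omega), hzero h, card_sq_eq_zero_prime_pow, Nat.cast_pow, ← pow_add,
        ← pow_add, show ℓ + ℓ / 2 = ℓ - 1 + (ℓ - ℓ / 2) by omega, sub_self, mul_zero, mul_zero]
  · rintro ⟨k, rfl⟩ rfl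
    obtain ⟨j, rfl⟩ := Nat.exists_eq_add_of_le' (show 1 ≤ k by omega)
    rw [hlarge le_rfl, hdiv]
    simp only [Nat.add_sub_cancel]
    rw [card_sq_eq_prime_pow_even_mul hp2,
      show 2 * (j + 1) + 1 - (2 * (j + 1) + 1) / 2 = j + 2 by omega,
      show (2 * (j + 1) + 1 - 3) / 2 = j by omega]
    field_simp
    ring
  · rintro ⟨k, hk⟩ h
    obtain ⟨j, rfl⟩ := Nat.exists_eq_add_of_le' (show 1 ≤ k by omega)
    obtain rfl : ℓ = 2 * j + 2 := by omega
    rw [hlarge (by omega), hzero h, card_sq_eq_zero_prime_pow, Nat.cast_pow,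
      show (2 * j + 2) / 2 = j + 1 by omega, show 2 * j + 2 - (j + 1) = j + 1 by omega,
      show 2 * j + 2 - 1 = 2 * j + 1 by omega, show (2 * j + 2 - 2) / 2 = j by omega,
      show (p : ℂ) ^ 2 - 1 = (p - 1) * (p + 1) by ring]
    field_simp
    ring
  · rintro ⟨k, hk⟩ rfl
    obtain ⟨j, rfl⟩ := Nat.exists_eq_add_of_le' (show 1 ≤ k by omega)
    obtain rfl : ℓ = 2 * (j + 1) := by omega
    rw [hlarge le_rfl, card_sq_eq_prime_pow_odd_mul (by omega) hpd,
      show 2 * (j + 1) / 2 = j + 1 by omega, show 2 * (j + 1) - (j + 1) = j + 1 by omega,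
      show 2 * (j + 1) - 1 = 2 * j + 1 by omega, show (2 * (j + 1) - 2) / 2 = j by omega,
      show 2 * (j + 1) = 2 * j + 2 by ring, Nat.cast_zero, mul_zero, zero_sub]
    field_simp
    ring
end

section
/- Let Γ be a subgroup of SL₂(ℤ), p a prime, ℓ ≥ 0, and A, B, C, D integers. For each m ≥ 0 let G_m denote the image of Γ under the entrywise reduction homomorphism SL₂(ℤ) → SL₂(ℤ/p^mℤ) (a finite group), and for n ∈ ℤ set 𝔖^Γ_{p^m}(n) := |G_m|⁻¹ · Σ_{g ∈ G_m} c_{p^m}(ℒ(g) − n). Then Σ_{m=0}^{ℓ} 𝔖^Γ_{p^m}(n) = p^ℓ · |{g ∈ G_ℓ : ℒ(g) = n in ℤ/p^ℓℤ}| / |G_ℓ|. -/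
/-- The image of `Γ ≤ SL₂(ℤ)` under entrywise reduction `SL₂(ℤ) → SL₂(ℤ/qℤ)`. -/
def redSubgroup (Γ : Subgroup (Matrix.SpecialLinearGroup (Fin 2) ℤ)) (q : ℕ) :
    Subgroup (Matrix.SpecialLinearGroup (Fin 2) (ZMod q)) :=
  Γ.map (Matrix.SpecialLinearGroup.map (Int.castRingHom (ZMod q)))

open Finset in
theorem sum_range_exp_eq_ite (q : ℕ) (hq : q ≠ 0) (x : ℕ) :
    ∑ r ∈ range q, Complex.exp (2 * Real.pi * Complex.I * ((r * x : ℕ) : ℂ) / q) =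
      if q ∣ x then (q : ℂ) else 0 := by
  have hqc : (q : ℂ) ≠ 0 := Nat.cast_ne_zero.mpr hq
  set z : ℂ := Complex.exp (2 * Real.pi * Complex.I * (x / q : ℂ)) with hz
  have hpow (r : ℕ) :
      Complex.exp (2 * Real.pi * Complex.I * ((r * x : ℕ) : ℂ) / q) = z ^ r := by
    rw [hz, ← Complex.exp_nat_mul]
    congr 1
    push_cast
    ring
  have hz_iff : z = 1 ↔ q ∣ x := by
    rw [hz, Complex.exp_eq_one_iff]
    constructor
    · rintro ⟨k, hk⟩
      have h : (x : ℂ) / q = k :=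
        mul_left_cancel₀ Complex.two_pi_I_ne_zero (by rw [hk]; ring)
      rw [div_eq_iff hqc] at h
      have h' : (x : ℤ) = k * q := by exact_mod_cast h
      exact Int.natCast_dvd_natCast.mp ⟨k, by rw [h', mul_comm]⟩
    · rintro ⟨k, rfl⟩
      refine ⟨k, ?_⟩
      push_cast
      field_simp
  have hzq : z ^ q = 1 := by
    rw [← hpow, Complex.exp_eq_one_iff]
    refine ⟨x, ?_⟩
    push_cast
    field_simp
  simp_rw [hpow]
  split_ifs with h
  · simp [hz_iff.mpr h]
  · rw [geom_sum_eq (mt hz_iff.mp h), hzq, sub_self, zero_div]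

theorem exp_mul_zmod_val_eq (q : ℕ) (hq : q ≠ 0) (r x : ℕ) :
    Complex.exp (2 * Real.pi * Complex.I * ((r * (x : ZMod q).val : ℕ) : ℂ) / q) =
      Complex.exp (2 * Real.pi * Complex.I * ((r * x : ℕ) : ℂ) / q) := by
  have hqc : (q : ℂ) ≠ 0 := Nat.cast_ne_zero.mpr hq
  rw [ZMod.val_natCast, Complex.exp_eq_exp_iff_exists_int]
  obtain ⟨k, hk⟩ : ∃ k, x = x % q + q * k := ⟨x / q, (Nat.mod_add_div x q).symm⟩
  refine ⟨-(r * k : ℕ), ?_⟩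
  have h : (x : ℂ) = (x % q : ℕ) + q * k := by exact_mod_cast hk
  push_cast
  rw [h]
  field_simp
  ring

open Finset in
theorem ramanujanSum_prime_pow_succ (p : ℕ) [hp : Fact p.Prime] (m x : ℕ) :
    ramanujanSum (p ^ (m + 1)) (x : ZMod (p ^ (m + 1))) =
      (if p ^ (m + 1) ∣ x then ((p ^ (m + 1) : ℕ) : ℂ) else 0) -
        if p ^ m ∣ x then ((p ^ m : ℕ) : ℂ) else 0 := by
  have hp0 : p ≠ 0 := hp.out.ne_zero
  rw [ramanujanSum, ← sum_range_exp_eq_ite _ (pow_ne_zero _ hp0),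
    ← sum_range_exp_eq_ite _ (pow_ne_zero _ hp0), eq_sub_iff_add_eq,
    ← sum_filter_add_sum_filter_not (range (p ^ (m + 1))) (fun r => Nat.Coprime r (p ^ (m + 1)))]
  congr 1
  · exact sum_congr rfl fun r _ => exp_mul_zmod_val_eq _ (pow_ne_zero _ hp0) r x
  · have himage : (range (p ^ (m + 1))).filter (fun r => ¬ Nat.Coprime r (p ^ (m + 1))) =
        (range (p ^ m)).image (p * ·) := by
      ext r
      simp only [mem_filter, mem_range, mem_image,
        Nat.coprime_pow_right_iff (Nat.succ_pos m), Nat.coprime_comm (n := r),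
        hp.out.coprime_iff_not_dvd, not_not]
      constructor
      · rintro ⟨hr, s, rfl⟩
        rw [pow_succ'] at hr
        exact ⟨s, lt_of_mul_lt_mul_left' hr, rfl⟩
      · rintro ⟨s, hs, rfl⟩
        rw [pow_succ']
        exact ⟨Nat.mul_lt_mul_of_pos_left hs hp.out.pos, dvd_mul_right _ _⟩
    rw [himage, sum_image fun a _ b _ h => Nat.eq_of_mul_eq_mul_left hp.out.pos h]
    refine sum_congr rfl fun s _ => ?_
    congr 1
    have hpc : (p : ℂ) ≠ 0 := Nat.cast_ne_zero.mpr hp0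
    push_cast
    field_simp
    ring

theorem sum_ramanujanSum_natCast (p : ℕ) [hp : Fact p.Prime] (ℓ x : ℕ) :
    ∑ m ∈ Finset.range (ℓ + 1), ramanujanSum (p ^ m) (x : ZMod (p ^ m)) =
      if p ^ ℓ ∣ x then ((p ^ ℓ : ℕ) : ℂ) else 0 := by
  induction ℓ with
  | zero => simp [ramanujanSum, Finset.filter_true_of_mem]
  | succ ℓ ih => rw [Finset.sum_range_succ, ih, ramanujanSum_prime_pow_succ]; ring

theorem sum_ramanujanSum_intCast (p : ℕ) [hp : Fact p.Prime] (ℓ : ℕ) (x : ℤ) :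
    ∑ m ∈ Finset.range (ℓ + 1), ramanujanSum (p ^ m) (x : ZMod (p ^ m)) =
      if (x : ZMod (p ^ ℓ)) = 0 then (p : ℂ) ^ ℓ else 0 := by
  have hcast : ∀ m ∈ Finset.range (ℓ + 1),
      (x : ZMod (p ^ m)) = (((x : ZMod (p ^ ℓ)).val : ℕ) : ZMod (p ^ m)) := by
    intro m hm
    have hd : p ^ m ∣ p ^ ℓ := pow_dvd_pow p (Nat.lt_succ_iff.mp (Finset.mem_range.mp hm))
    rw [ZMod.natCast_val, ZMod.cast_intCast hd]
  rw [Finset.sum_congr rfl fun m hm => congrArg (ramanujanSum (p ^ m)) (hcast m hm),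
    sum_ramanujanSum_natCast]
  simp only [← ZMod.natCast_eq_zero_iff, ZMod.natCast_val, ZMod.cast_id', id_eq, Nat.cast_pow]

theorem MonoidHom.average_comp_of_surjective {G H : Type*} [Group G] [Group H] [Fintype G]
    [Fintype H] (f : G →* H) (hf : Function.Surjective f) (F : H → ℂ) :
    (Nat.card H : ℂ)⁻¹ * ∑ h, F h = (Nat.card G : ℂ)⁻¹ * ∑ g, F (f g) := by
  classical
  have hfiber (h : H) : (Finset.univ.filter fun g => f g = h).card =
      (Finset.univ.filter fun g => f g = 1).card :=
    MonoidHom.card_fiber_eq_of_mem_range f (hf h) (hf 1)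
  have hsum (E : H → ℂ) : ∑ g, E (f g) =
      ((Finset.univ.filter fun g => f g = 1).card : ℂ) * ∑ h, E h := by
    rw [← Finset.sum_fiberwise Finset.univ f, Finset.mul_sum]
    refine Finset.sum_congr rfl fun h _ => ?_
    rw [Finset.sum_congr rfl fun g hg => congrArg E (Finset.mem_filter.mp hg).2,
      Finset.sum_const, hfiber, nsmul_eq_mul]
  have hcard := hsum fun _ => 1
  simp only [Finset.sum_const, Finset.card_univ, nsmul_eq_mul, mul_one] at hcard
  have hG : (Fintype.card G : ℂ) ≠ 0 := Nat.cast_ne_zero.mpr Fintype.card_ne_zero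
  have hH : (Fintype.card H : ℂ) ≠ 0 := Nat.cast_ne_zero.mpr Fintype.card_ne_zero
  rw [Nat.card_eq_fintype_card, Nat.card_eq_fintype_card, hsum, inv_mul_eq_div, inv_mul_eq_div,
    div_eq_div_iff hH hG, hcard]
  ring

theorem Lform_map_intCast (A B C D : ℤ) (q : ℕ) (γ : Matrix.SpecialLinearGroup (Fin 2) ℤ) :
    Lform A B C D (Matrix.SpecialLinearGroup.map (Int.castRingHom (ZMod q)) γ) =
      ((A * γ.1 0 0 + B * γ.1 0 1 + C * γ.1 1 0 + D * γ.1 1 1 : ℤ) : ZMod q) := by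
  simp [Lform]

theorem map_castHom_map_intCast {q q' : ℕ} (hd : q' ∣ q)
    (γ : Matrix.SpecialLinearGroup (Fin 2) ℤ) :
    Matrix.SpecialLinearGroup.map (ZMod.castHom hd (ZMod q'))
        (Matrix.SpecialLinearGroup.map (Int.castRingHom (ZMod q)) γ) =
      Matrix.SpecialLinearGroup.map (Int.castRingHom (ZMod q')) γ := by
  ext i j
  simp

theorem redSubgroup_map_castHom (Γ : Subgroup (Matrix.SpecialLinearGroup (Fin 2) ℤ)) {q q' : ℕ}
    (hd : q' ∣ q) :
    (redSubgroup Γ q).map (Matrix.SpecialLinearGroup.map (ZMod.castHom hd (ZMod q'))) =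
      redSubgroup Γ q' := by
  rw [redSubgroup, redSubgroup, Subgroup.map_map]
  congr 1
  exact MonoidHom.ext (map_castHom_map_intCast hd)

theorem average_redSubgroup_of_dvd (Γ : Subgroup (Matrix.SpecialLinearGroup (Fin 2) ℤ)) {q q' : ℕ}
    (hd : q' ∣ q) [Fintype (redSubgroup Γ q)] [Fintype (redSubgroup Γ q')]
    (F : Matrix.SpecialLinearGroup (Fin 2) (ZMod q') → ℂ) :
    (Nat.card (redSubgroup Γ q') : ℂ)⁻¹ * ∑ g : redSubgroup Γ q', F g =
      (Nat.card (redSubgroup Γ q) : ℂ)⁻¹ * ∑ g : redSubgroup Γ q,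
        F (Matrix.SpecialLinearGroup.map (ZMod.castHom hd (ZMod q')) g) := by
  have hmap := redSubgroup_map_castHom Γ hd
  let f : redSubgroup Γ q →* redSubgroup Γ q' :=
    ((Matrix.SpecialLinearGroup.map (ZMod.castHom hd (ZMod q'))).comp
      (redSubgroup Γ q).subtype).codRestrict (redSubgroup Γ q') fun g =>
        hmap ▸ Subgroup.mem_map_of_mem _ g.2
  have hf : Function.Surjective f := by
    rintro ⟨h, hh⟩
    obtain ⟨g, hg, rfl⟩ := hmap ▸ hh
    exact ⟨⟨g, hg⟩, rfl⟩
  exact MonoidHom.average_comp_of_surjective f hf fun h => F h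

open scoped Classical in
/-- Density interpretation of the partial sums of the local singular series of a subgroup
`Γ ≤ SL₂(ℤ)`:
`Σ_{m=0}^{ℓ} 𝔖^Γ_{p^m}(n) = p^ℓ · #{g ∈ G_ℓ : ℒ(g) = n} / #G_ℓ`. -/
theorem singSeries_partial_sum_eq_density (Γ : Subgroup (Matrix.SpecialLinearGroup (Fin 2) ℤ))
    (p : ℕ) [Fact p.Prime] (ℓ : ℕ) (A B C D : ℤ) (n : ℤ) :
    (∑ m ∈ Finset.range (ℓ + 1),
      (Nat.card (redSubgroup Γ (p ^ m)) : ℂ)⁻¹ *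
        ∑ g : redSubgroup Γ (p ^ m),
          ramanujanSum (p ^ m) (Lform A B C D (g : Matrix.SpecialLinearGroup (Fin 2)
            (ZMod (p ^ m))) - (n : ZMod (p ^ m)))) =
    (p : ℂ) ^ ℓ *
      (Nat.card {g : Matrix.SpecialLinearGroup (Fin 2) (ZMod (p ^ ℓ)) //
          g ∈ redSubgroup Γ (p ^ ℓ) ∧ Lform A B C D g = (n : ZMod (p ^ ℓ))} : ℂ) /
      (Nat.card (redSubgroup Γ (p ^ ℓ)) : ℂ) := by
  have havg : ∀ m ∈ Finset.range (ℓ + 1),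
      (Nat.card (redSubgroup Γ (p ^ m)) : ℂ)⁻¹ * ∑ g : redSubgroup Γ (p ^ m),
          ramanujanSum (p ^ m) (Lform A B C D (g : Matrix.SpecialLinearGroup (Fin 2)
            (ZMod (p ^ m))) - (n : ZMod (p ^ m))) =
        (Nat.card (redSubgroup Γ (p ^ ℓ)) : ℂ)⁻¹ * ∑ g : redSubgroup Γ (p ^ ℓ),
          ramanujanSum (p ^ m) (Lform A B C D
            (Matrix.SpecialLinearGroup.map (Int.castRingHom (ZMod (p ^ m))) g.2.choose) -
              (n : ZMod (p ^ m))) := by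
    intro m hm
    have hd : p ^ m ∣ p ^ ℓ := pow_dvd_pow p (Nat.lt_succ_iff.mp (Finset.mem_range.mp hm))
    rw [average_redSubgroup_of_dvd Γ hd
      fun g => ramanujanSum (p ^ m) (Lform A B C D g - (n : ZMod (p ^ m)))]
    congr 1
    refine Finset.sum_congr rfl fun g _ => ?_
    rw [← map_castHom_map_intCast hd, g.2.choose_spec.2]
  have hpoint (g : redSubgroup Γ (p ^ ℓ)) :
      ∑ m ∈ Finset.range (ℓ + 1), ramanujanSum (p ^ m) (Lform A B C D
          (Matrix.SpecialLinearGroup.map (Int.castRingHom (ZMod (p ^ m))) g.2.choose) -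
            (n : ZMod (p ^ m))) =
        if Lform A B C D g.1 = (n : ZMod (p ^ ℓ)) then (p : ℂ) ^ ℓ else 0 := by
    simp_rw [Lform_map_intCast, ← Int.cast_sub]
    rw [sum_ramanujanSum_intCast, Int.cast_sub, ← Lform_map_intCast, g.2.choose_spec.2]
    simp only [sub_eq_zero]
  have hcard : Nat.card {g : Matrix.SpecialLinearGroup (Fin 2) (ZMod (p ^ ℓ)) //
        g ∈ redSubgroup Γ (p ^ ℓ) ∧ Lform A B C D g = (n : ZMod (p ^ ℓ))} =
      (Finset.univ.filter fun g : redSubgroup Γ (p ^ ℓ) =>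
        Lform A B C D g.1 = (n : ZMod (p ^ ℓ))).card := by
    rw [← Fintype.card_subtype, ← Nat.card_eq_fintype_card]
    exact Nat.card_congr (Equiv.subtypeSubtypeEquivSubtypeInter _ _).symm
  rw [Finset.sum_congr rfl havg, ← Finset.mul_sum, Finset.sum_comm,
    Finset.sum_congr rfl fun g _ => hpoint g, ← Finset.sum_filter, Finset.sum_const, hcard,
    nsmul_eq_mul]
  ring
end
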